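/- Let P be a simple grid polygon with C cells that contains no narrow-passage cell. Then there exist a cell s ∈ P and a closed walk in P starting and ending at s that covers P and has length at most (4/3)·C − 2. -/

import Mathlib

/-- A cell of the integer grid. -/
abbrev Cell : Type := ℤ × ℤ

/-- Two cells are edge-adjacent if they differ by exactly 1 in one coordinate
and 0 in the other. -/
def EdgeAdj (c d : Cell) : Prop :=
  (c.1 - d.1).natAbs + (c.2 - d.2).natAbs = 1

/-- Two cells are touching if they are distinct and differ by at most 1
in each coordinate. -/
def Touching (c d : Cell) : Prop :=
  c ≠ d ∧ (c.1 - d.1).natAbs ≤ 1 ∧ (c.2 - d.2).natAbs ≤ 1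

/-- A set of cells is connected under a relation `R` if any two of its members
are joined by a chain inside the set. -/
def ConnectedUnder (R : Cell → Cell → Prop) (S : Set Cell) : Prop :=
  ∀ c ∈ S, ∀ d ∈ S, Relation.ReflTransGen (fun a b => a ∈ S ∧ b ∈ S ∧ R a b) c d

/-- A grid polygon: a finite nonempty set of cells, connected under edge-adjacency. -/
def GridPolygon (P : Finset Cell) : Prop :=
  P.Nonempty ∧ ConnectedUnder EdgeAdj (↑P : Set Cell)

/-- A simple grid polygon: a grid polygon whose complement is connected under
touching-adjacency (no holes). -/
def SimplePolygon (P : Finset Cell) : Prop :=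
  GridPolygon P ∧ ConnectedUnder Touching ((↑P : Set Cell)ᶜ)

/-- The four edge-neighbors of a cell. -/
def nbrs (c : Cell) : Finset Cell :=
  {(c.1 + 1, c.2), (c.1 - 1, c.2), (c.1, c.2 + 1), (c.1, c.2 - 1)}

/-- The perimeter of a finite set of cells: the number of ordered pairs `(c, d)`
of edge-adjacent cells with `c ∈ S` and `d ∉ S`. -/
def perimeter (S : Finset Cell) : ℕ :=
  ∑ c ∈ S, ((nbrs c).filter (fun d => d ∉ S)).card

/-- `w 0, …, w n` is a walk in `P`: all cells belong to `P` and consecutive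
cells are edge-adjacent. -/
def IsWalk (P : Finset Cell) (w : ℕ → Cell) (n : ℕ) : Prop :=
  (∀ i ≤ n, w i ∈ P) ∧ ∀ i < n, EdgeAdj (w i) (w (i + 1))

/-- The walk `w 0, …, w n` covers `P`: every cell of `P` occurs among the `w i`. -/
def Covers (P : Finset Cell) (w : ℕ → Cell) (n : ℕ) : Prop :=
  ∀ c ∈ P, ∃ i ≤ n, w i = c

/-- The eight cells touching a cell. -/
def touchNbrs (c : Cell) : Finset Cell :=
  {(c.1 + 1, c.2), (c.1 - 1, c.2), (c.1, c.2 + 1), (c.1, c.2 - 1),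
   (c.1 + 1, c.2 + 1), (c.1 + 1, c.2 - 1), (c.1 - 1, c.2 + 1), (c.1 - 1, c.2 - 1)}

/-- The offset of a set of cells: the cells all of whose touching cells
belong to the set (the set with its first layer removed). -/
def offset (S : Finset Cell) : Finset Cell :=
  S.filter (fun c => touchNbrs c ⊆ S)

/-- The layer number of a cell `c` in `P`: the unique `ℓ ≥ 1` with
`c ∈ offset^[ℓ-1] P \ offset^[ℓ] P`, i.e. the least `ℓ` with `c ∉ offset^[ℓ] P`. -/
noncomputable def layerNum (P : Finset Cell) (c : Cell) : ℕ :=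
  sInf {ℓ : ℕ | c ∉ offset^[ℓ] P}

/-- `c` is a narrow-passage cell of `P` if removing it changes no other
cell's layer number. -/
def IsNarrowPassageCell (P : Finset Cell) (c : Cell) : Prop :=
  c ∈ P ∧ ∀ d ∈ P.erase c, layerNum (P.erase c) d = layerNum P d



def Gr (P : Finset Cell) : SimpleGraph Cell where
  Adj c d := c ∈ P ∧ d ∈ P ∧ EdgeAdj c d
  symm := ⟨by
    rintro c d ⟨h1, h2, h3⟩
    refine ⟨h2, h1, ?_⟩
    unfold EdgeAdj at *
    omega⟩
  loopless := ⟨by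
    rintro c ⟨_, _, h⟩
    unfold EdgeAdj at h
    omega⟩

abbrev CWalk (P : Finset Cell) := Σ u, (Gr P).Walk u u

def St (P : Finset Cell) (k n : ℕ) (Q : Set Cell) (A : Set (Sym2 Cell)) : Prop :=
  ∃ L : Multiset (CWalk P), L.card = k ∧ (L.map (fun w => w.2.length)).sum = n ∧
    (∀ w ∈ L, ∀ v ∈ w.2.support, v ∈ P) ∧ (∀ c ∈ Q, ∃ w ∈ L, c ∈ w.2.support) ∧
    (∀ e ∈ A, ∃ w ∈ L, e ∈ w.2.edges)

lemma walk_split {P : Finset Cell} {a b : Cell} (p : (Gr P).Walk a b) (d : (Gr P).Dart)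
    (hd : d ∈ p.darts) : ∃ (p1 : (Gr P).Walk a d.fst) (p2 : (Gr P).Walk d.snd b),
      p = p1.append (SimpleGraph.Walk.cons d.adj p2) := by
  induction p with
  | nil => simp at hd
  | cons h q ih =>
    rw [SimpleGraph.Walk.darts_cons, List.mem_cons] at hd
    rcases hd with rfl | hd
    · exact ⟨.nil, q, rfl⟩
    · obtain ⟨p1, p2, rfl⟩ := ih hd
      exact ⟨.cons h p1, p2, rfl⟩

lemma cw_split_dart {P : Finset Cell} {a : Cell} (p : (Gr P).Walk a a) (d : (Gr P).Dart)
    (hd : d ∈ p.darts) : ∃ (q : (Gr P).Walk d.snd d.fst),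
      p.length = q.length + 1 ∧ (∀ e ∈ p.edges, e = s(d.fst, d.snd) ∨ e ∈ q.edges) ∧
      (∀ v, v ∈ p.support ↔ v ∈ q.support) := by
  obtain ⟨p1, p2, h⟩ := walk_split p d hd
  refine ⟨p2.append p1, ?_, ?_, ?_⟩
  · rw [h]; simp; omega
  · rw [h]; intro e; simp; tauto
  · rw [h]; intro v
    simp only [SimpleGraph.Walk.mem_support_append_iff, SimpleGraph.Walk.support_cons, List.mem_cons]
    have h1 := p1.end_mem_support
    have h2 := p1.start_mem_support
    constructor
    · rintro (h | rfl | h) <;> tauto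
    · tauto

lemma cw_split {P : Finset Cell} {a u v : Cell} (p : (Gr P).Walk a a)
    (hd : s(u, v) ∈ p.edges) : ∃ (q : (Gr P).Walk v u),
      p.length = q.length + 1 ∧ (∀ e ∈ p.edges, e = s(u, v) ∨ e ∈ q.edges) ∧
      (∀ c, c ∈ p.support ↔ c ∈ q.support) := by
  rw [SimpleGraph.Walk.edges, List.mem_map] at hd
  obtain ⟨d, hd, he⟩ := hd
  obtain ⟨q, h1, h2, h3⟩ := cw_split_dart p d hd
  have he' : s(d.fst, d.snd) = s(u, v) := he
  rw [he'] at h2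
  rw [Sym2.eq_iff] at he'
  rcases d with ⟨⟨x, y⟩, hxy⟩
  rcases he' with ⟨h, h'⟩ | ⟨h, h'⟩
  · dsimp at h h' q h1 h2 h3
    subst h h'
    exact ⟨q, h1, h2, h3⟩
  · dsimp at h h' q h1 h2 h3
    subst h h'
    exact ⟨q.reverse, by simpa using h1, by simpa using h2, by simpa using h3⟩

lemma St.mono {P : Finset Cell} {k n : ℕ} {Q Q' : Set Cell} {A A' : Set (Sym2 Cell)}
    (h : St P k n Q A) (hQ : Q' ⊆ Q) (hA : A' ⊆ A) : St P k n Q' A' := by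
  obtain ⟨L, h1, h2, h3, h4, h5⟩ := h
  exact ⟨L, h1, h2, h3, fun c hc => h4 c (hQ hc), fun e he => h5 e (hA he)⟩

lemma St.nil (P : Finset Cell) : St P 0 0 ∅ ∅ :=
  ⟨0, by simp⟩

lemma St.base {P : Finset Cell} {u v : Cell} (h : (Gr P).Adj u v) :
    St P 1 2 {u, v} {s(u, v)} := by
  refine ⟨{⟨u, .cons h (.cons h.symm .nil)⟩}, by simp, by simp, ?_, ?_, ?_⟩
  · simp only [Multiset.mem_singleton, forall_eq]
    have := h.1; have := h.2.1
    simp; tauto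
  · simp
  · simp

lemma St.union {P : Finset Cell} {k n k' n' : ℕ} {Q Q' : Set Cell} {A A' : Set (Sym2 Cell)}
    (h : St P k n Q A) (h' : St P k' n' Q' A') :
    St P (k + k') (n + n') (Q ∪ Q') (A ∪ A') := by
  obtain ⟨L, h1, h2, h3, h4, h5⟩ := h
  obtain ⟨L', h1', h2', h3', h4', h5'⟩ := h'
  refine ⟨L + L', by simp [h1, h1'], by simp [h2, h2'], ?_, ?_, ?_⟩
  · intro w hw
    rcases Multiset.mem_add.1 hw with hw | hw
    · exact h3 w hw
    · exact h3' w hw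
  · rintro c (hc | hc)
    · obtain ⟨w, hw, h⟩ := h4 c hc
      exact ⟨w, Multiset.mem_add.2 (Or.inl hw), h⟩
    · obtain ⟨w, hw, h⟩ := h4' c hc
      exact ⟨w, Multiset.mem_add.2 (Or.inr hw), h⟩
  · rintro c (hc | hc)
    · obtain ⟨w, hw, h⟩ := h5 c hc
      exact ⟨w, Multiset.mem_add.2 (Or.inl hw), h⟩
    · obtain ⟨w, hw, h⟩ := h5' c hc
      exact ⟨w, Multiset.mem_add.2 (Or.inr hw), h⟩

lemma St.pair {P : Finset Cell} {k n : ℕ} {Q : Set Cell} {A : Set (Sym2 Cell)}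
    (h : St P k n Q A) {u v u' v' : Cell} (he : s(u, v) ∈ A)
    (a1 : (Gr P).Adj u u') (a2 : (Gr P).Adj u' v') (a3 : (Gr P).Adj v' v) :
    St P k (n + 2) (Q ∪ {u', v'}) ((A \ {s(u, v)}) ∪ {s(u, u'), s(u', v'), s(v', v)}) := by
  obtain ⟨L, h1, h2, h3, h4, h5⟩ := h
  obtain ⟨w, hw, hwe⟩ := h5 _ he
  obtain ⟨L0, rfl⟩ := Multiset.exists_cons_of_mem hw
  obtain ⟨q, q1, q2, q3⟩ := cw_split w.2 hwe
  let w' : CWalk P := ⟨u, .cons a1 (.cons a2 (.cons a3 q))⟩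
  refine ⟨w' ::ₘ L0, by simpa using h1, ?_, ?_, ?_, ?_⟩
  · simp only [Multiset.map_cons, Multiset.sum_cons] at h2 ⊢
    simp only [w', SimpleGraph.Walk.length_cons]
    omega
  · intro x hx
    rcases Multiset.mem_cons.1 hx with rfl | hx
    · intro c hc
      simp only [w', SimpleGraph.Walk.support_cons, List.mem_cons] at hc
      rcases hc with rfl | rfl | rfl | hc
      · exact a1.1
      · exact a2.1
      · exact a3.1
      · exact h3 w hw c ((q3 c).2 hc)
    · exact h3 x (Multiset.mem_cons_of_mem hx)
  · rintro c (hc | hc)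
    · obtain ⟨x, hx, hcx⟩ := h4 c hc
      rcases Multiset.mem_cons.1 hx with rfl | hx
      · refine ⟨w', Multiset.mem_cons_self _ _, ?_⟩
        simp only [w', SimpleGraph.Walk.support_cons, List.mem_cons]
        have := (q3 c).1 hcx
        tauto
      · exact ⟨x, Multiset.mem_cons_of_mem hx, hcx⟩
    · refine ⟨w', Multiset.mem_cons_self _ _, ?_⟩
      simp only [w', SimpleGraph.Walk.support_cons, List.mem_cons]
      rcases hc with rfl | hc
      · tauto
      · rw [Set.mem_singleton_iff] at hc
        tauto
  · rintro e (⟨hc, hne⟩ | hc)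
    · obtain ⟨x, hx, hcx⟩ := h5 e hc
      rcases Multiset.mem_cons.1 hx with rfl | hx
      · refine ⟨w', Multiset.mem_cons_self _ _, ?_⟩
        simp only [w', SimpleGraph.Walk.edges_cons, List.mem_cons]
        rcases q2 e hcx with h | h
        · exact absurd h hne
        · tauto
      · exact ⟨x, Multiset.mem_cons_of_mem hx, hcx⟩
    · refine ⟨w', Multiset.mem_cons_self _ _, ?_⟩
      simp only [w', SimpleGraph.Walk.edges_cons, List.mem_cons]
      simp only [Set.mem_insert_iff, Set.mem_singleton_iff] at hc
      tauto

lemma St.leaf {P : Finset Cell} {k n : ℕ} {Q : Set Cell} {A : Set (Sym2 Cell)}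
    (h : St P k n Q A) {u v : Cell} (hu : u ∈ Q) (a1 : (Gr P).Adj u v) :
    St P k (n + 2) (Q ∪ {v}) A := by
  obtain ⟨L, h1, h2, h3, h4, h5⟩ := h
  obtain ⟨w, hw, hwe⟩ := h4 _ hu
  obtain ⟨L0, rfl⟩ := Multiset.exists_cons_of_mem hw
  let q := (w.2.takeUntil u hwe)
  let r := (w.2.dropUntil u hwe)
  have hqr : q.append r = w.2 := w.2.take_spec hwe
  let w' : CWalk P := ⟨w.1, q.append (.cons a1 (.cons a1.symm r))⟩
  have hs : ∀ c, c ∈ w'.2.support ↔ c ∈ w.2.support ∨ c = v := by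
    intro c
    rw [← hqr]
    simp only [w', SimpleGraph.Walk.mem_support_append_iff, SimpleGraph.Walk.support_cons,
      List.mem_cons]
    have := q.end_mem_support
    constructor
    · rintro (h | rfl | rfl | h) <;> tauto
    · tauto
  have hl : w'.2.length = w.2.length + 2 := by
    rw [← hqr]
    simp [w']
    omega
  have hed : ∀ e ∈ w.2.edges, e ∈ w'.2.edges := by
    rw [← hqr]
    intro e
    simp [w']
    tauto
  refine ⟨w' ::ₘ L0, by simpa using h1, ?_, ?_, ?_, ?_⟩
  · simp only [Multiset.map_cons, Multiset.sum_cons] at h2 ⊢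
    omega
  · intro x hx
    rcases Multiset.mem_cons.1 hx with rfl | hx
    · intro c hc
      rcases (hs c).1 hc with hc | rfl
      · exact h3 w hw c hc
      · exact a1.2.1
    · exact h3 x (Multiset.mem_cons_of_mem hx)
  · rintro c (hc | hc)
    · obtain ⟨x, hx, hcx⟩ := h4 c hc
      rcases Multiset.mem_cons.1 hx with rfl | hx
      · exact ⟨w', Multiset.mem_cons_self _ _, (hs c).2 (Or.inl hcx)⟩
      · exact ⟨x, Multiset.mem_cons_of_mem hx, hcx⟩
    · exact ⟨w', Multiset.mem_cons_self _ _, (hs c).2 (Or.inr hc)⟩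
  · rintro e hc
    obtain ⟨x, hx, hcx⟩ := h5 e hc
    rcases Multiset.mem_cons.1 hx with rfl | hx
    · exact ⟨w', Multiset.mem_cons_self _ _, hed e hcx⟩
    · exact ⟨x, Multiset.mem_cons_of_mem hx, hcx⟩

lemma St.merge {P : Finset Cell} {k n k' n' : ℕ} {Q Q' : Set Cell} {A A' : Set (Sym2 Cell)}
    (h : St P k n Q A) (h' : St P (k' + 1) n' Q' A') {u v u' v' : Cell}
    (he : s(u, v) ∈ A) (he' : s(u', v') ∈ A')
    (a1 : (Gr P).Adj u u') (a3 : (Gr P).Adj v v') :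
    St P (k + k') (n + n') (Q ∪ Q') ((A \ {s(u, v)}) ∪ (A' \ {s(u', v')})) := by
  obtain ⟨L, h1, h2, h3, h4, h5⟩ := h
  obtain ⟨L', h1', h2', h3', h4', h5'⟩ := h'
  obtain ⟨w, hw, hwe⟩ := h5 _ he
  obtain ⟨L0, rfl⟩ := Multiset.exists_cons_of_mem hw
  obtain ⟨q, q1, q2, q3⟩ := cw_split w.2 hwe
  obtain ⟨x, hx, hxe⟩ := h5' _ he'
  obtain ⟨L1, rfl⟩ := Multiset.exists_cons_of_mem hx
  rw [Sym2.eq_swap] at hxe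
  obtain ⟨r, r1, r2, r3⟩ := cw_split x.2 hxe
  let w' : CWalk P := ⟨v, q.append (.cons a1 (r.append (.cons a3.symm .nil)))⟩
  have hs : ∀ c, c ∈ w'.2.support ↔ c ∈ w.2.support ∨ c ∈ x.2.support := by
    intro c
    rw [q3, r3]
    simp only [w', SimpleGraph.Walk.mem_support_append_iff, SimpleGraph.Walk.support_cons,
      List.mem_cons, SimpleGraph.Walk.support_nil, List.not_mem_nil, or_false]
    have := q.end_mem_support
    have := q.start_mem_support
    have := r.end_mem_support
    constructor
    · rintro (h | rfl | h | rfl | rfl) <;> tauto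
    · tauto
  have hl : w'.2.length = w.2.length + x.2.length := by
    simp [w']
    omega
  have hed : ∀ e, (e ∈ q.edges ∨ e ∈ r.edges) → e ∈ w'.2.edges := by
    intro e
    simp [w']
    tauto
  have hm : ∀ y, y ∈ L0 ∨ y ∈ L1 → y ∈ w' ::ₘ (L0 + L1) := by
    intro y hy
    exact Multiset.mem_cons_of_mem (Multiset.mem_add.2 hy)
  refine ⟨w' ::ₘ (L0 + L1), ?_, ?_, ?_, ?_, ?_⟩
  · simp at h1 h1' ⊢
    omega
  · simp only [Multiset.map_cons, Multiset.sum_cons, Multiset.map_add, Multiset.sum_add] at h2 h2' ⊢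
    omega
  · intro y hy
    rcases Multiset.mem_cons.1 hy with rfl | hy
    · intro c hc
      rcases (hs c).1 hc with hc | hc
      · exact h3 w hw c hc
      · exact h3' x hx c hc
    · rcases Multiset.mem_add.1 hy with hy | hy
      · exact h3 y (Multiset.mem_cons_of_mem hy)
      · exact h3' y (Multiset.mem_cons_of_mem hy)
  · rintro c (hc | hc)
    · obtain ⟨y, hy, hcy⟩ := h4 c hc
      rcases Multiset.mem_cons.1 hy with rfl | hy
      · exact ⟨w', Multiset.mem_cons_self _ _, (hs c).2 (Or.inl hcy)⟩
      · exact ⟨y, hm y (Or.inl hy), hcy⟩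
    · obtain ⟨y, hy, hcy⟩ := h4' c hc
      rcases Multiset.mem_cons.1 hy with rfl | hy
      · exact ⟨w', Multiset.mem_cons_self _ _, (hs c).2 (Or.inr hcy)⟩
      · exact ⟨y, hm y (Or.inr hy), hcy⟩
  · rintro e (⟨hc, hne⟩ | ⟨hc, hne⟩)
    · obtain ⟨y, hy, hcy⟩ := h5 e hc
      rcases Multiset.mem_cons.1 hy with rfl | hy
      · refine ⟨w', Multiset.mem_cons_self _ _, hed e (Or.inl ?_)⟩
        rcases q2 e hcy with h | h
        · exact absurd h hne
        · exact h
      · exact ⟨y, hm y (Or.inl hy), hcy⟩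
    · obtain ⟨y, hy, hcy⟩ := h5' e hc
      rcases Multiset.mem_cons.1 hy with rfl | hy
      · refine ⟨w', Multiset.mem_cons_self _ _, hed e (Or.inr ?_)⟩
        rcases r2 e hcy with h | h
        · rw [Sym2.eq_swap] at h
          exact absurd h hne
        · exact h
      · exact ⟨y, hm y (Or.inr hy), hcy⟩

/-- joining two closed walks through a common or adjacent cell -/
lemma cw_join {P : Finset Cell} (w x : CWalk P) {u v : Cell} (hu : u ∈ w.2.support)
    (hv : v ∈ x.2.support) (h : u = v ∨ (Gr P).Adj u v) :
    ∃ y : CWalk P, y.2.length ≤ w.2.length + x.2.length + 2 ∧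
      ∀ c, c ∈ y.2.support ↔ c ∈ w.2.support ∨ c ∈ x.2.support := by
  let a := w.2.rotate u hu
  let b := x.2.rotate v hv
  have ha : ∀ c, c ∈ a.support ↔ c ∈ w.2.support := by
    intro c; simp [a]
  have hb : ∀ c, c ∈ b.support ↔ c ∈ x.2.support := by
    intro c; simp [b]
  have la : a.length = w.2.length := by simp [a]
  have lb : b.length = x.2.length := by simp [b]
  rcases h with h | h
  · generalize a = a, b = b at *
    subst h
    refine ⟨⟨u, a.append b⟩, ?_, ?_⟩
    · simp; omega
    · intro c
      simp only [SimpleGraph.Walk.mem_support_append_iff, ha, hb]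
  · refine ⟨⟨u, a.append (.cons h (b.append (.cons h.symm .nil)))⟩, ?_, ?_⟩
    · simp; omega
    · intro c
      rw [← ha, ← hb]
      simp only [SimpleGraph.Walk.mem_support_append_iff, SimpleGraph.Walk.support_cons,
        List.mem_cons, SimpleGraph.Walk.support_nil, List.not_mem_nil, or_false]
      have := a.start_mem_support
      have := b.start_mem_support
      constructor
      · rintro (h | rfl | h | rfl | rfl) <;> tauto
      · tauto

lemma exists_cross {P : Finset Cell} (hP : GridPolygon P) (S T : Set Cell)
    (hS : ∃ c ∈ S, c ∈ P) (hT : ∃ c ∈ T, c ∈ P) (hST : ∀ c ∈ P, c ∈ S ∨ c ∈ T) :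
    ∃ u ∈ S, ∃ v ∈ T, u = v ∨ (Gr P).Adj u v := by
  obtain ⟨s, hs, hsP⟩ := hS
  obtain ⟨t, ht, htP⟩ := hT
  have h := hP.2 s hsP t htP
  by_contra hcon
  push Not at hcon
  have : t ∈ S := by
    clear ht
    induction h with
    | refl => exact hs
    | tail h1 h2 ih =>
      have hb := ih h2.1
      rcases hST _ htP with h | h
      · exact h
      · exact absurd ⟨h2.1, h2.2.1, h2.2.2⟩ (hcon _ hb _ h).2
  exact (hcon t this t ht).1 rfl

lemma St.final {P : Finset Cell} (hP : GridPolygon P) : ∀ {k n : ℕ} {A : Set (Sym2 Cell)},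
    St P k n (↑P : Set Cell) A → ∃ y : CWalk P, y.2.length + 2 ≤ n + 2 * k ∧
      (∀ c, c ∈ P ↔ c ∈ y.2.support) := by
  intro k
  induction k with
  | zero =>
    rintro n A ⟨L, h1, h2, h3, h4, h5⟩
    obtain ⟨c, hc⟩ := hP.1
    obtain ⟨w, hw, _⟩ := h4 c hc
    rw [Multiset.card_eq_zero] at h1
    simp [h1] at hw
  | succ k ih =>
    rintro n A ⟨L, h1, h2, h3, h4, h5⟩
    obtain ⟨w, L0, rfl⟩ := Multiset.card_pos_iff_exists_mem.1 (by omega : 0 < L.card) |>.imp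
      fun w hw => Multiset.exists_cons_of_mem hw
    rcases Multiset.empty_or_exists_mem L0 with rfl | ⟨x, hx⟩
    · refine ⟨w, ?_, ?_⟩
      · simp at h1 h2; omega
      · intro c
        constructor
        · intro hc
          obtain ⟨x, hx, hcx⟩ := h4 c hc
          simp at hx
          subst hx
          exact hcx
        · exact h3 w (Multiset.mem_cons_self _ _) c
    · obtain ⟨u, hu, v, ⟨x, hx, hv⟩, huv⟩ := exists_cross hP {c | c ∈ w.2.support}
        {c | ∃ x ∈ L0, c ∈ x.2.support}
        ⟨w.1, w.2.start_mem_support, h3 w (Multiset.mem_cons_self _ _) _ w.2.start_mem_support⟩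
        ⟨x.1, ⟨x, hx, x.2.start_mem_support⟩,
          h3 x (Multiset.mem_cons_of_mem hx) _ x.2.start_mem_support⟩
        (by
          intro c hc
          obtain ⟨y, hy, hcy⟩ := h4 c hc
          rcases Multiset.mem_cons.1 hy with rfl | hy
          · exact Or.inl hcy
          · exact Or.inr ⟨y, hy, hcy⟩)
      obtain ⟨L1, rfl⟩ := Multiset.exists_cons_of_mem hx
      obtain ⟨y, hy, hys⟩ := cw_join w x hu hv huv
      simp only [Multiset.map_cons, Multiset.sum_cons, Multiset.card_cons] at h1 h2
      have := @ih (y.2.length + (L1.map (fun w => w.2.length)).sum) ∅ ⟨y ::ₘ L1, by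
          simp; omega, by simp, ?_, ?_, by simp⟩
      · obtain ⟨z, hz, hz'⟩ := this
        exact ⟨z, by omega, hz'⟩
      · intro z hz
        rcases Multiset.mem_cons.1 hz with rfl | hz
        · intro c hc
          rcases (hys c).1 hc with hc | hc
          · exact h3 w (by simp) c hc
          · exact h3 x (by simp) c hc
        · exact h3 z (by simp [hz])
      · intro c hc
        obtain ⟨z, hz, hcz⟩ := h4 c hc
        simp only [Multiset.mem_cons] at hz
        rcases hz with rfl | rfl | hz
        · exact ⟨y, by simp, (hys c).2 (Or.inl hcz)⟩
        · exact ⟨y, by simp, (hys c).2 (Or.inr hcz)⟩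
        · exact ⟨z, by simp [hz], hcz⟩

lemma final_walk {P : Finset Cell} (y : CWalk P) (hs : ∀ c, c ∈ P ↔ c ∈ y.2.support) :
    ∃ s ∈ P, ∃ (w : ℕ → Cell) (n : ℕ),
      w 0 = s ∧ IsWalk P w n ∧ w n = s ∧ Covers P w n ∧ n = y.2.length := by
  refine ⟨y.1, (hs _).2 y.2.start_mem_support, y.2.getVert, y.2.length, by simp, ⟨?_, ?_⟩,
    by simp, ?_, rfl⟩
  · intro i _
    exact (hs _).2 (y.2.getVert_mem_support i)
  · intro i hi
    exact (y.2.adj_getVert_succ hi).2.2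
  · intro c hc
    obtain ⟨i, h1, h2⟩ := SimpleGraph.Walk.mem_support_iff_exists_getVert.1 ((hs c).1 hc)
    exact ⟨i, h2, h1⟩

open Finset in
lemma runs_induction (p : Finset ℤ → Prop) (h0 : p ∅)
    (hs : ∀ (D : Finset ℤ) (b t : ℤ), b ≤ t → (∀ z ∈ D, z + 1 < b) → p D → p (D ∪ Icc b t)) :
    ∀ D, p D := by
  intro D
  induction D using Finset.strongInduction with
  | H D ih =>
    rcases D.eq_empty_or_nonempty with rfl | hne
    · exact h0
    · set t := D.max' hne with ht
      have htD : t ∈ D := D.max'_mem hne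
      have hle : ∀ z ∈ D, z ≤ t := fun z hz => D.le_max' z hz
      have hF : (D.filter (fun b => Icc b t ⊆ D)).Nonempty := by
        refine ⟨t, ?_⟩
        simp [htD]
      set b := (D.filter (fun b => Icc b t ⊆ D)).min' hF with hb
      have hbm := (D.filter (fun b => Icc b t ⊆ D)).min'_mem hF
      rw [← hb, mem_filter] at hbm
      have hbmin : ∀ z, z ∈ D → Icc z t ⊆ D → b ≤ z := fun z h1 h2 =>
        Finset.min'_le _ _ (mem_filter.2 ⟨h1, h2⟩)
      have hbt := hle b hbm.1
      have hb1 : b - 1 ∉ D := by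
        intro h
        have := hbmin (b - 1) h (by
          intro z hz
          rw [mem_Icc] at hz
          rcases eq_or_ne z (b - 1) with rfl | hne
          · exact h
          · exact hbm.2 (mem_Icc.2 ⟨by omega, hz.2⟩))
        omega
      have hlt : ∀ z ∈ D \ Icc b t, z + 1 < b := by
        intro z hz
        rw [mem_sdiff, mem_Icc] at hz
        have := hle z hz.1
        have : z ≠ b - 1 := by rintro rfl; exact hb1 hz.1
        omega
      have hss : D \ Icc b t ⊂ D := by
        refine ⟨sdiff_subset, fun h => ?_⟩
        have := h htD
        rw [mem_sdiff, mem_Icc] at this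
        omega
      have := hs (D \ Icc b t) b t hbt hlt (ih _ hss)
      rwa [sdiff_union_of_subset hbm.2] at this

open Finset in
lemma runs_induction' (D : Finset ℤ) (p : Finset ℤ → Prop) (h0 : p ∅)
    (hs : ∀ (D' : Finset ℤ) (b t : ℤ), b ≤ t → D' ⊆ D → Icc b t ⊆ D → b - 1 ∉ D → t + 1 ∉ D →
      (∀ z ∈ D', z + 1 < b) → p D' → p (D' ∪ Icc b t)) : p D := by
  have := runs_induction (fun D' => D' ⊆ D → (∀ z ∈ D', z + 1 ∈ D → z + 1 ∈ D') →
    (∀ z ∈ D', z - 1 ∈ D → z - 1 ∈ D') → p D') (fun _ _ _ => h0) ?_ D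
  · exact this (Subset.refl _) (fun _ _ h => h) (fun _ _ h => h)
  · intro D' b t hbt hlt ih hsub h1 h2
    have hD' : D' ⊆ D := subset_union_left.trans hsub
    have hI : Icc b t ⊆ D := subset_union_right.trans hsub
    refine hs D' b t hbt hD' hI ?_ ?_ hlt (ih hD' ?_ ?_)
    · intro h
      have := h2 b (by simp [hbt]) h
      rw [mem_union, mem_Icc] at this
      rcases this with h | h
      · have := hlt _ h; omega
      · omega
    · intro h
      have := h1 t (by simp [hbt]) h
      rw [mem_union, mem_Icc] at this
      rcases this with h | h
      · have := hlt _ h; omega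
      · omega
    · intro z hz hz1
      have := h1 z (mem_union_left _ hz) hz1
      rw [mem_union, mem_Icc] at this
      have := hlt z hz
      rcases ‹_ ∨ _› with h | h
      · exact h
      · omega
    · intro z hz hz1
      have := h2 z (mem_union_left _ hz) hz1
      rw [mem_union, mem_Icc] at this
      have := hlt z hz
      rcases ‹_ ∨ _› with h | h
      · exact h
      · omega

def St2 (P : Finset Cell) (m : ℕ) (Q : Set Cell) (A : Set (Sym2 Cell)) : Prop :=
  ∃ k n, St P k n Q A ∧ n + 2 * k ≤ m

lemma St2.mono {P : Finset Cell} {m m' : ℕ} {Q Q' : Set Cell} {A A' : Set (Sym2 Cell)}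
    (h : St2 P m Q A) (hQ : Q' ⊆ Q) (hA : A' ⊆ A) (hm : m ≤ m') : St2 P m' Q' A' := by
  obtain ⟨k, n, h, h'⟩ := h
  exact ⟨k, n, h.mono hQ hA, by omega⟩

/-- vertical edge -/
def ed (c y : ℤ) : Sym2 Cell := s((c, y), (c, y + 1))

lemma ed_inj {c d y z : ℤ} : ed c y = ed d z ↔ c = d ∧ y = z := by
  unfold ed
  rw [Sym2.eq_iff]
  simp only [Prod.mk.injEq]
  omega

lemma ed_ne_hd {c d d' y z : ℤ} (h : d ≠ d') : ed c y ≠ s((d, z), (d', z)) := by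
  unfold ed
  rw [Ne, Sym2.eq_iff]
  simp only [Prod.mk.injEq]
  omega

def EE (c : ℤ) (S : Finset ℤ) : Set (Sym2 Cell) :=
  {e | ∃ y, y ∈ S ∧ y + 1 ∈ S ∧ e = ed c y}

lemma EE_mono {c : ℤ} {S T : Finset ℤ} (h : S ⊆ T) : EE c S ⊆ EE c T := by
  rintro e ⟨y, h1, h2, h3⟩
  exact ⟨y, h h1, h h2, h3⟩

def colset (c : ℤ) (S : Finset ℤ) : Set Cell := {z | z.1 = c ∧ z.2 ∈ S}

lemma adj_h {P : Finset Cell} {x x' y : ℤ} (h1 : (x, y) ∈ P) (h2 : (x', y) ∈ P)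
    (h : x' = x + 1 ∨ x = x' + 1) : (Gr P).Adj (x, y) (x', y) := by
  refine ⟨h1, h2, ?_⟩
  unfold EdgeAdj
  simp only
  omega

lemma adj_v {P : Finset Cell} {x y y' : ℤ} (h1 : (x, y) ∈ P) (h2 : (x, y') ∈ P)
    (h : y' = y + 1 ∨ y = y' + 1) : (Gr P).Adj (x, y) (x, y') := by
  refine ⟨h1, h2, ?_⟩
  unfold EdgeAdj
  simp only
  omega

open Finset in
lemma cycle_strip {P : Finset Cell} (x b t : ℤ) (hbt : b ≤ t)
    (hP : ∀ y ∈ Icc b t, (x, y) ∈ P ∧ (x + 1, y) ∈ P) :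
    St P 1 (2 * (Icc b t).card) (colset x (Icc b t) ∪ colset (x + 1) (Icc b t))
      (EE x (Icc b t) ∪ EE (x + 1) (Icc b t) ∪ {s((x, t), (x + 1, t))}) := by
  induction t, hbt using Int.leInduction with
  | base =>
    have h := hP b (by simp)
    have := St.base (adj_h h.1 h.2 (Or.inl rfl))
    simp only [Icc_self, card_singleton]
    refine this.mono ?_ ?_
    · rintro ⟨c, d⟩
      simp [colset]
    · rintro e ((⟨y, h1, h2, h3⟩ | ⟨y, h1, h2, h3⟩) | h)
      · simp at h1 h2; omega
      · simp at h1 h2; omega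
      · exact h
  | succ t hbt ih =>
    have h1 := hP t (by simp [hbt])
    have h2 := hP (t + 1) (by simp; omega)
    have := (ih (fun y hy => hP y (by rw [mem_Icc] at *; omega))).pair (u := (x, t))
      (v := (x + 1, t)) (u' := (x, t + 1)) (v' := (x + 1, t + 1)) (Or.inr rfl)
      (adj_v h1.1 h2.1 (Or.inl rfl)) (adj_h h2.1 h2.2 (Or.inl rfl)) (adj_v h2.2 h1.2 (Or.inr rfl))
    have hc : (Icc b (t + 1)).card = (Icc b t).card + 1 := by
      simp only [Int.card_Icc]; omega
    rw [hc, Nat.mul_add]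
    refine this.mono ?_ ?_
    · rintro ⟨c, d⟩
      simp only [colset, Set.mem_union, Set.mem_ofPred_eq, mem_Icc, Set.mem_insert_iff,
        Set.mem_singleton_iff, Prod.mk.injEq]
      omega
    · rintro e ((⟨y, h1, h2, rfl⟩ | ⟨y, h1, h2, rfl⟩) | h)
      · rw [mem_Icc] at h1 h2
        rcases eq_or_ne y t with rfl | hne
        · right; left; rfl
        · left
          refine ⟨Or.inl (Or.inl ⟨y, by rw [mem_Icc]; omega, by rw [mem_Icc]; omega, rfl⟩), ?_⟩
          exact ed_ne_hd (by omega)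
      · rw [mem_Icc] at h1 h2
        rcases eq_or_ne y t with rfl | hne
        · right; right; right
          exact Sym2.eq_swap
        · left
          refine ⟨Or.inl (Or.inr ⟨y, by rw [mem_Icc]; omega, by rw [mem_Icc]; omega, rfl⟩), ?_⟩
          exact ed_ne_hd (by omega)
      · right; right; left
        exact h

/-- the run of `D` starting at `b` has two consecutive rows in `M` -/
def Mrg (D M : Finset ℤ) (b : ℤ) : Prop :=
  ∃ y, b ≤ y ∧ Finset.Icc b (y + 1) ⊆ D ∧ y ∈ M ∧ y + 1 ∈ M

open Classical in
noncomputable def NN (D M : Finset ℤ) : ℕ :=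
  (D.filter (fun b => b - 1 ∉ D ∧ ¬ Mrg D M b)).card

open Finset in
open Classical in
lemma strips {P : Finset Cell} (x : ℤ) (D M : Finset ℤ) {m : ℕ} {Q : Set Cell}
    (h : St2 P m Q (EE (x - 1) M))
    (hD : ∀ y ∈ D, (x, y) ∈ P ∧ (x + 1, y) ∈ P) (hM : ∀ y ∈ M, (x - 1, y) ∈ P) :
    St2 P (m + 2 * D.card + 2 * NN D M) (Q ∪ (colset x D ∪ colset (x + 1) D))
      (EE (x - 1) (M \ D) ∪ EE x (D \ M) ∪ EE (x + 1) D) := by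
  unfold NN
  refine runs_induction' D (fun D' => St2 P (m + 2 * D'.card +
    2 * (D'.filter (fun b => b - 1 ∉ D ∧ ¬ Mrg D M b)).card) (Q ∪ (colset x D' ∪ colset (x + 1) D'))
      (EE (x - 1) (M \ D') ∪ EE x (D' \ M) ∪ EE (x + 1) D')) ?_ ?_
  · refine h.mono ?_ ?_ (by simp)
    · rintro c (h | h)
      · exact h
      · simp [colset] at h
    · rintro c ((⟨y, h1, h2, h3⟩ | ⟨y, h1, h2, h3⟩) | ⟨y, h1, h2, h3⟩)
      · exact ⟨y, by simpa using h1, by simpa using h2, h3⟩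
      · simp at h1
      · simp at h1
  · intro D' b t hbt hD'D hI hb ht hlt ⟨k, n, hst, hkn⟩
    have hcyc := cycle_strip x b t hbt (fun y hy => hD y (hI hy))
    have hdis : Disjoint D' (Icc b t) := by
      rw [disjoint_left]
      intro z hz hz'
      have := hlt z hz
      rw [mem_Icc] at hz'
      omega
    have hcard : (D' ∪ Icc b t).card = D'.card + (Icc b t).card := card_union_of_disjoint hdis
    have hQ : Q ∪ (colset x (D' ∪ Icc b t) ∪ colset (x + 1) (D' ∪ Icc b t)) ⊆
        (Q ∪ (colset x D' ∪ colset (x + 1) D')) ∪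
          (colset x (Icc b t) ∪ colset (x + 1) (Icc b t)) := by
      rintro ⟨c, d⟩
      simp only [colset, Set.mem_union, Set.mem_ofPred_eq, mem_union]
      tauto
    have hsplit : ∀ y, y ∈ D' ∪ Icc b t → y + 1 ∈ D' ∪ Icc b t →
        (y ∈ D' ∧ y + 1 ∈ D') ∨ (y ∈ Icc b t ∧ y + 1 ∈ Icc b t) := by
      intro y h1 h2
      rw [mem_union] at h1 h2
      rcases h1 with h1 | h1 <;> rcases h2 with h2 | h2
      · exact Or.inl ⟨h1, h2⟩
      · have := hlt _ h1
        rw [mem_Icc] at h2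
        omega
      · have := hlt _ h2
        rw [mem_Icc] at h1
        omega
      · exact Or.inr ⟨h1, h2⟩
    by_cases hm : ∃ y, y ∈ Icc b t ∧ y + 1 ∈ Icc b t ∧ y ∈ M ∧ y + 1 ∈ M
    · obtain ⟨y, hy1, hy2, hy3, hy4⟩ := hm
      have hn1 : y ∉ D' := disjoint_right.1 hdis hy1
      have hn2 : y + 1 ∉ D' := disjoint_right.1 hdis hy2
      have hmg := St.merge (k' := 0) hst hcyc (u := (x - 1, y)) (v := (x - 1, y + 1))
        (u' := (x, y)) (v' := (x, y + 1))
        (Or.inl (Or.inl ⟨y, mem_sdiff.2 ⟨hy3, hn1⟩, mem_sdiff.2 ⟨hy4, hn2⟩, rfl⟩))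
        (Or.inl (Or.inl ⟨y, hy1, hy2, rfl⟩))
        (adj_h (hM _ hy3) (hD _ (hI hy1)).1 (Or.inl (by ring)))
        (adj_h (hM _ hy4) (hD _ (hI hy2)).1 (Or.inl (by ring)))
      refine ⟨_, _, hmg.mono hQ ?_, ?_⟩
      · change (_ : Set (Sym2 Cell)) ⊆ (_ \ ({ed (x - 1) y} : Set (Sym2 Cell))) ∪ (_ \ ({ed x y} : Set (Sym2 Cell)))
        rintro e ((⟨z, h1, h2, rfl⟩ | ⟨z, h1, h2, rfl⟩) | ⟨z, h1, h2, rfl⟩)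
        · rw [mem_sdiff, notMem_union] at h1 h2
          left
          refine ⟨Or.inl (Or.inl ⟨z, mem_sdiff.2 ⟨h1.1, h1.2.1⟩, mem_sdiff.2 ⟨h2.1, h2.2.1⟩, rfl⟩), ?_⟩
          rw [Set.mem_singleton_iff, ed_inj]
          rintro ⟨-, rfl⟩
          exact h1.2.2 hy1
        · rw [mem_sdiff] at h1 h2
          rcases hsplit z h1.1 h2.1 with h | h
          · left
            refine ⟨Or.inl (Or.inr ⟨z, mem_sdiff.2 ⟨h.1, h1.2⟩, mem_sdiff.2 ⟨h.2, h2.2⟩, rfl⟩), ?_⟩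
            rw [Set.mem_singleton_iff, ed_inj]
            omega
          · right
            refine ⟨Or.inl (Or.inl ⟨z, h.1, h.2, rfl⟩), ?_⟩
            rw [Set.mem_singleton_iff, ed_inj]
            rintro ⟨-, rfl⟩
            exact h1.2 hy3
        · rcases hsplit z h1 h2 with h | h
          · left
            refine ⟨Or.inr ⟨z, h.1, h.2, rfl⟩, ?_⟩
            rw [Set.mem_singleton_iff, ed_inj]
            omega
          · right
            refine ⟨Or.inl (Or.inr ⟨z, h.1, h.2, rfl⟩), ?_⟩
            rw [Set.mem_singleton_iff, ed_inj]
            omega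
      · rw [hcard]
        have : (D'.filter (fun b => b - 1 ∉ D ∧ ¬ Mrg D M b)).card ≤
          ((D' ∪ Icc b t).filter (fun b => b - 1 ∉ D ∧ ¬ Mrg D M b)).card :=
          card_le_card (filter_subset_filter _ subset_union_left)
        omega
    · have hun := hst.union hcyc
      refine ⟨_, _, hun.mono hQ ?_, ?_⟩
      · rintro e ((⟨z, h1, h2, rfl⟩ | ⟨z, h1, h2, rfl⟩) | ⟨z, h1, h2, rfl⟩)
        · rw [mem_sdiff, notMem_union] at h1 h2
          left
          exact (Or.inl (Or.inl ⟨z, mem_sdiff.2 ⟨h1.1, h1.2.1⟩, mem_sdiff.2 ⟨h2.1, h2.2.1⟩, rfl⟩))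
        · rw [mem_sdiff] at h1 h2
          rcases hsplit z h1.1 h2.1 with h | h
          · left
            exact (Or.inl (Or.inr ⟨z, mem_sdiff.2 ⟨h.1, h1.2⟩, mem_sdiff.2 ⟨h.2, h2.2⟩, rfl⟩))
          · right
            exact (Or.inl (Or.inl ⟨z, h.1, h.2, rfl⟩))
        · rcases hsplit z h1 h2 with h | h
          · left
            exact Or.inr ⟨z, h.1, h.2, rfl⟩
          · right
            exact (Or.inl (Or.inr ⟨z, h.1, h.2, rfl⟩))
      · rw [hcard]
        have hbI : b ∈ Icc b t := by simp [hbt]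
        have : (D'.filter (fun b => b - 1 ∉ D ∧ ¬ Mrg D M b)).card + 1 ≤
          ((D' ∪ Icc b t).filter (fun b => b - 1 ∉ D ∧ ¬ Mrg D M b)).card := by
          rw [← card_insert_of_notMem (a := b)]
          · apply card_le_card
            intro z hz
            rw [mem_insert, mem_filter] at hz
            rw [mem_filter, mem_union]
            rcases hz with rfl | hz
            · refine ⟨Or.inr hbI, hb, ?_⟩
              rintro ⟨y, h1, h2, h3, h4⟩
              have hyt : y + 1 ≤ t := by
                by_contra hcon
                exact ht (h2 (mem_Icc.2 ⟨by omega, by omega⟩))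
              exact hm ⟨y, mem_Icc.2 ⟨by omega, by omega⟩, mem_Icc.2 ⟨by omega, by omega⟩, h3, h4⟩
            · tauto
          · rw [mem_filter]
            exact fun h => disjoint_right.1 hdis hbI h.1
        omega

def nr (S : Finset ℤ) : ℕ := (S.filter (fun y => y + 1 ∉ S)).card

open Finset in
lemma singles {P : Finset Cell} (c c' : ℤ) (hc : c' = c + 1 ∨ c = c' + 1) : ∀ (S : Finset ℤ)
    {m : ℕ} {Q : Set Cell} {A : Set (Sym2 Cell)}
    (_ : St2 P m Q A) (_ : colset c S ⊆ Q) (_ : EE c S ⊆ A)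
    (_ : ∀ y ∈ S, (c, y) ∈ P ∧ (c', y) ∈ P),
    St2 P (m + S.card + nr S) (Q ∪ colset c' S) (A \ EE c S) := by
  intro S
  induction S using Finset.strongInduction with
  | H S ih =>
    intro m Q A h hQ hA hS
    rcases S.eq_empty_or_nonempty with rfl | hne
    · refine h.mono ?_ Set.sdiff_subset (by simp)
      rintro z (h | h)
      · exact h
      · simp [colset] at h
    · set t := S.max' hne with ht
      have htS : t ∈ S := S.max'_mem hne
      have hle : ∀ z ∈ S, z ≤ t := fun z hz => S.le_max' z hz
      have ht1 : t + 1 ∉ S := fun h => by have := hle _ h; omega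
      have htn : t ∈ S.filter (fun y => y + 1 ∉ S) := mem_filter.2 ⟨htS, ht1⟩
      have hnrpos : 0 < nr S := card_pos.2 ⟨t, htn⟩
      have hce := card_erase_of_mem htn
      have hnr : (S.filter (fun y => y + 1 ∉ S)).card = nr S := rfl
      obtain ⟨k, n, hst, hkn⟩ := h
      by_cases h1 : t - 1 ∈ S
      · have e1 : t - 1 + 1 = t := by ring
        have hp := hst.pair (u := (c, t - 1)) (v := (c, t)) (u' := (c', t - 1)) (v' := (c', t))
          (hA ⟨t - 1, h1, by rwa [e1], by rw [ed, e1]⟩)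
          (adj_h (hS _ h1).1 (hS _ h1).2 hc)
          (adj_v (hS _ h1).2 (hS _ htS).2 (Or.inl (by ring)))
          (adj_h (hS _ htS).2 (hS _ htS).1 hc.symm)
        set S' := (S.erase t).erase (t - 1) with hS'
        have hmem : ∀ z, z ∈ S' ↔ z ∈ S ∧ z ≠ t ∧ z ≠ t - 1 := by
          intro z; simp [hS']; tauto
        have hcard : S'.card + 2 = S.card := by
          have := card_pos.2 ⟨t, htS⟩
          have h2 : t - 1 ∈ S.erase t := mem_erase.2 ⟨by omega, h1⟩
          have := card_pos.2 ⟨_, h2⟩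
          rw [hS', card_erase_of_mem h2, card_erase_of_mem htS] at *
          omega
        have hsub : S' ⊆ S := fun z hz => ((hmem z).1 hz).1
        have hnr' : nr S' ≤ nr S := by
          have : S'.filter (fun y => y + 1 ∉ S') ⊆
              insert (t - 2) ((S.filter (fun y => y + 1 ∉ S)).erase t) := by
            intro z hz
            rw [mem_filter, hmem, hmem] at hz
            rw [mem_insert, mem_erase, mem_filter]
            by_cases h : z = t - 2
            · exact Or.inl h
            · right
              refine ⟨hz.1.2.1, hz.1.1, fun h' => hz.2 ⟨h', ?_, ?_⟩⟩
              · omega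
              · omega
          have h3 := (card_le_card this).trans (card_insert_le _ _)
          unfold nr at *
          omega
        have key := ih S' ⟨hsub, fun h => absurd ((hmem t).1 (h htS)).2.1 (by simp)⟩
          (m := m + 2) ⟨k, n + 2, hp, by omega⟩ ?_ ?_ (fun y hy => hS y (hsub hy))
        · refine key.mono ?_ ?_ (by omega)
          · rintro ⟨a, b⟩
            simp only [colset, Set.mem_union, Set.mem_ofPred_eq, Set.mem_insert_iff,
              Set.mem_singleton_iff, Prod.mk.injEq, hmem]
            tauto
          · rintro e ⟨he1, he2⟩
            refine ⟨Or.inl ⟨he1, ?_⟩, fun h => he2 (EE_mono hsub h)⟩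
            rintro rfl
            exact he2 ⟨t - 1, h1, by rwa [e1], by rw [ed, e1]⟩
        · rintro z ⟨hz1, hz2⟩
          exact Or.inl (hQ ⟨hz1, hsub hz2⟩)
        · rintro e ⟨y, hy1, hy2, rfl⟩
          left
          refine ⟨hA ⟨y, hsub hy1, hsub hy2, rfl⟩, ?_⟩
          have : s((c, t - 1), (c, t)) = ed c (t - 1) := by rw [ed, e1]
          rw [this, Set.mem_singleton_iff, ed_inj]
          rintro ⟨-, rfl⟩
          exact ((hmem _).1 hy1).2.2 rfl
      · have hp := hst.leaf (u := (c, t)) (v := (c', t)) (hQ ⟨rfl, htS⟩)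
          (adj_h (hS _ htS).1 (hS _ htS).2 hc)
        set S' := (S.erase t) with hS'
        have hmem : ∀ z, z ∈ S' ↔ z ∈ S ∧ z ≠ t := by
          intro z; simp [hS']; tauto
        have hcard : S'.card + 1 = S.card := by
          have := card_pos.2 ⟨t, htS⟩
          rw [hS', card_erase_of_mem htS]
          omega
        have hsub : S' ⊆ S := fun z hz => ((hmem z).1 hz).1
        have hnr' : nr S' + 1 ≤ nr S := by
          have : S'.filter (fun y => y + 1 ∉ S') ⊆
              ((S.filter (fun y => y + 1 ∉ S)).erase t) := by
            intro z hz
            rw [mem_filter, hmem, hmem] at hz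
            rw [mem_erase, mem_filter]
            refine ⟨hz.1.2, hz.1.1, fun h' => hz.2 ⟨h', ?_⟩⟩
            intro h2
            apply h1
            rw [← h2]
            simpa using hz.1.1
          have h3 := (card_le_card this)
          unfold nr at *
          omega
        have key := ih S' ⟨hsub, fun h => absurd ((hmem t).1 (h htS)).2 (by simp)⟩
          (m := m + 2) ⟨k, n + 2, hp, by omega⟩ ?_ ?_ (fun y hy => hS y (hsub hy))
        · refine key.mono ?_ ?_ (by omega)
          · rintro ⟨a, b⟩
            simp only [colset, Set.mem_union, Set.mem_ofPred_eq, 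
              Set.mem_singleton_iff, Prod.mk.injEq, hmem]
            tauto
          · rintro e ⟨he1, he2⟩
            exact ⟨he1, fun h => he2 (EE_mono hsub h)⟩
        · rintro z ⟨hz1, hz2⟩
          exact Or.inl (hQ ⟨hz1, hsub hz2⟩)
        · rintro e ⟨y, hy1, hy2, rfl⟩
          exact hA ⟨y, hsub hy1, hsub hy2, rfl⟩

def DD (G : ℤ → Finset ℤ) (x : ℤ) : Finset ℤ := G x ∪ G (x - 1)
def RR (G : ℤ → Finset ℤ) (x : ℤ) : Finset ℤ := G (x - 2) \ (G (x - 1) ∪ G x)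
def LL (G : ℤ → Finset ℤ) (x : ℤ) : Finset ℤ := G x \ (G (x - 1) ∪ G (x - 2))
noncomputable def cost (G : ℤ → Finset ℤ) (x : ℤ) : ℕ :=
  2 * (DD G x).card + 2 * NN (DD G x) (DD G (x - 2)) + ((RR G x).card + nr (RR G x)) +
    ((LL G (x - 1)).card + nr (LL G (x - 1)))

lemma stage {P : Finset Cell} {G : ℤ → Finset ℤ}
    (hG : ∀ x y, (x, y) ∈ P ↔ y ∈ G x ∨ y ∈ G (x - 1) ∨ y ∈ G (x - 2)) (x : ℤ) {m : ℕ}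
    (h : St2 P m ({c | c ∈ P ∧ c.1 ≤ x - 2} ∪ colset (x - 1) (DD G (x - 2)))
      (EE (x - 1) (DD G (x - 2)))) :
    St2 P (m + cost G x) ({c | c ∈ P ∧ c.1 ≤ x} ∪ colset (x + 1) (DD G x))
      (EE (x + 1) (DD G x)) := by
  have a1 : x - 1 - 1 = x - 2 := by ring
  have a2 : x - 1 - 2 = x - 3 := by ring
  have a3 : x - 2 - 1 = x - 3 := by ring
  have a4 : x + 1 - 1 = x := by ring
  have a5 : x + 1 - 2 = x - 1 := by ring
  have h1 := strips x (DD G x) (DD G (x - 2)) h (by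
    intro y hy
    rw [hG, hG, a4, a5]
    simp only [DD, Finset.mem_union] at hy
    tauto) (by
    intro y hy
    rw [hG, a1, a2]
    simp only [DD, Finset.mem_union, a3] at hy
    tauto)
  have h2 := singles (x - 1) x (Or.inl (by ring)) (RR G x) h1 (by
      rintro ⟨a, b⟩ ⟨ha, hb⟩
      simp only at ha hb
      left; right
      refine ⟨ha, ?_⟩
      simp only [RR, DD, Finset.mem_sdiff, Finset.mem_union] at hb ⊢
      tauto) (by
      intro e he
      left; left
      refine EE_mono ?_ he
      intro y hy
      simp only [RR, DD, Finset.mem_sdiff, Finset.mem_union] at hy ⊢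
      tauto) (by
      intro y hy
      rw [hG, hG, a1]
      simp only [RR, Finset.mem_sdiff, Finset.mem_union] at hy
      tauto)
  have h3 := singles x (x - 1) (Or.inr (by ring)) (LL G (x - 1)) h2 (by
      rintro ⟨a, b⟩ ⟨ha, hb⟩
      simp only at ha hb
      left; right; left
      refine ⟨ha, ?_⟩
      simp only [LL, DD, Finset.mem_sdiff, Finset.mem_union] at hb ⊢
      tauto) (by
      rintro e ⟨y, hy1, hy2, rfl⟩
      refine ⟨?_, ?_⟩
      · left; right
        refine ⟨y, ?_, ?_, rfl⟩
        · simp only [LL, DD, Finset.mem_sdiff, Finset.mem_union, a1, a2, a3] at hy1 ⊢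
          tauto
        · simp only [LL, DD, Finset.mem_sdiff, Finset.mem_union, a1, a2, a3] at hy2 ⊢
          tauto
      · rintro ⟨z, -, -, hz⟩
        rw [ed_inj] at hz
        omega) (by
      intro y hy
      rw [hG, hG]
      simp only [LL, Finset.mem_sdiff, Finset.mem_union] at hy
      tauto)
  refine h3.mono ?_ ?_ (by unfold cost; omega)
  · rintro ⟨a, b⟩ (⟨hab, hx⟩ | hab)
    · simp only at hx
      have hx' : a ≤ x - 2 ∨ a = x - 1 ∨ a = x := by omega
      rcases hx' with hx' | rfl | rfl
      · left; left; left; left; exact ⟨hab, hx'⟩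
      · by_cases hb : b ∈ LL G (x - 1)
        · right; exact ⟨rfl, hb⟩
        · left; left; left; right
          refine ⟨rfl, ?_⟩
          rw [hG] at hab
          simp only [LL, DD, Finset.mem_sdiff, Finset.mem_union, a1, a2, a3] at hb hab ⊢
          tauto
      · by_cases hb : b ∈ RR G a
        · left; right; exact ⟨rfl, hb⟩
        · left; left; right; left
          refine ⟨rfl, ?_⟩
          rw [hG] at hab
          simp only [RR, DD, Finset.mem_sdiff, Finset.mem_union] at hb hab ⊢
          tauto
    · left; left; right; right
      exact hab
  · intro e he
    have he' := he
    obtain ⟨y, -, -, rfl⟩ := he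
    refine ⟨⟨Or.inr he', ?_⟩, ?_⟩
    · rintro ⟨z, -, -, hz⟩
      rw [ed_inj] at hz
      omega
    · rintro ⟨z, -, -, hz⟩
      rw [ed_inj] at hz
      omega

lemma parity_tour {P : Finset Cell} (hP : GridPolygon P) {G : ℤ → Finset ℤ}
    (hG : ∀ x y, (x, y) ∈ P ↔ y ∈ G x ∨ y ∈ G (x - 1) ∨ y ∈ G (x - 2)) (x0 : ℤ) (N : ℕ)
    (h0 : ∀ x < x0, G x = ∅) (hN : ∀ c ∈ P, c.1 < x0 + 2 * N) :
    ∃ y : CWalk P, y.2.length + 2 ≤ ∑ k ∈ Finset.range N, cost G (x0 + 2 * k) + cost G (x0 + 2 * N) ∧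
      (∀ c, c ∈ P ↔ c ∈ y.2.support) := by
  have key : ∀ n : ℕ, St2 P (∑ k ∈ Finset.range n, cost G (x0 + 2 * k))
      ({c | c ∈ P ∧ c.1 ≤ x0 + 2 * n - 2} ∪ colset (x0 + 2 * n - 1) (DD G (x0 + 2 * n - 2)))
      (EE (x0 + 2 * n - 1) (DD G (x0 + 2 * n - 2))) := by
    intro n
    induction n with
    | zero =>
      refine ⟨0, 0, (St.nil P).mono ?_ ?_, by simp⟩
      · rintro ⟨a, b⟩ (⟨h, h'⟩ | ⟨h, h'⟩)
        · rw [hG, h0 a, h0 (a - 1), h0 (a - 2)] at h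
          · simp at h
          all_goals (simp at h'; omega)
        · simp only [DD] at h'
          rw [h0 _ (by simp), h0 _ (by simp)] at h'
          simp at h'
      · rintro e ⟨y, h, -, -⟩
        simp only [DD] at h
        rw [h0 _ (by simp), h0 _ (by simp)] at h
        simp at h
    | succ n ih =>
      rw [Finset.sum_range_succ]
      have := stage hG (x0 + 2 * n) ih
      have e1 : x0 + 2 * ((n + 1 : ℕ) : ℤ) - 2 = x0 + 2 * n := by push_cast; ring
      have e2 : x0 + 2 * ((n + 1 : ℕ) : ℤ) - 1 = x0 + 2 * n + 1 := by push_cast; ring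
      rw [e1, e2]
      exact this
  obtain ⟨k, n, hst, hkn⟩ := stage hG _ (key N)
  obtain ⟨y, h1, h2⟩ := St.final hP (hst.mono (Q' := (↑P : Set Cell)) (by
    intro c hc
    exact Or.inl ⟨hc, (hN c hc).le⟩) (Set.Subset.refl _))
  exact ⟨y, by omega, h2⟩

def Dl (V U : Finset ℤ) (z : ℤ) : Prop :=
  ∃ b, b ≤ z ∧ z ≤ b + 2 ∧ b ∈ V ∧ b + 1 ∈ V ∧ b + 2 ∈ V ∧ b - 1 ∉ V ∧ b + 3 ∉ V ∧
    ¬ (b ∈ U ∧ b + 1 ∈ U) ∧ ¬ (b + 1 ∈ U ∧ b + 2 ∈ U)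

lemma Dl.mem {V U : Finset ℤ} {z : ℤ} (h : Dl V U z) : z ∈ V := by
  obtain ⟨b, h1, h2, h3, h4, h5, -⟩ := h
  have : z = b ∨ z = b + 1 ∨ z = b + 2 := by omega
  rcases this with rfl | rfl | rfl <;> assumption

def Pay (U2 U1 V : Finset ℤ) (z : ℤ) : Prop :=
  z ∈ V ∧ Dl U1 U2 z ∧ ((z + 1 ∈ V ∧ Dl U1 U2 (z + 1)) ∨ (z - 1 ∈ V ∧ Dl U1 U2 (z - 1)))

/-- three-run property -/
def R3 (V : Finset ℤ) : Prop :=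
  ∀ y ∈ V, ∃ b, b ≤ y ∧ y ≤ b + 2 ∧ b ∈ V ∧ b + 1 ∈ V ∧ b + 2 ∈ V

def Ptn (U1 V W : Finset ℤ) : Prop :=
  ∀ b, b ∈ V → b + 1 ∈ V → b + 2 ∈ V → b - 1 ∉ V → b + 3 ∉ V →
    ∃ y, b ≤ y ∧ y ≤ b + 1 ∧ ((y ∈ U1 ∧ y + 1 ∈ U1) ∨ (y ∈ W ∧ y + 1 ∈ W))

noncomputable def io (p : Prop) : ℤ := by classical exact if p then 1 else 0

lemma io_true {p : Prop} (h : p) : io p = 1 := by simp [io, h]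
lemma io_false {p : Prop} (h : ¬ p) : io p = 0 := by simp [io, h]
lemma io_nonneg (p : Prop) : 0 ≤ io p := by unfold io; split_ifs <;> simp
lemma io_le (p : Prop) : io p ≤ 1 := by unfold io; split_ifs <;> simp

noncomputable def bse (U2 U1 V : Finset ℤ) (z : ℤ) : ℤ :=
  2 * io (z ∈ U1) - 2 * io (Pay U2 U1 V z) + 4 * io (z ∈ U2 \ U1) + 6 * io (z ∉ U1 ∪ U2) -
    3 * io (z ∉ U1 ∪ U2 ∧ z + 1 ∉ V \ (U1 ∪ U2)) + 3 * io (z ∈ U1 ∧ z + 1 ∉ U1) +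
    3 * io (z ∈ U2 \ U1 ∧ z + 1 ∉ U2 \ U1)

noncomputable def ngv (U2 U1 V : Finset ℤ) (z : ℤ) : ℤ :=
  3 * io (z + 1 ∉ V) + 3 * io (z ∈ U1 ∧ z - 1 ∈ U1 ∧ z - 1 ∉ V) +
    3 * io (z ∈ U2 \ U1 ∧ z - 1 ∈ U2 \ U1 ∧ z - 1 ∉ V)

lemma bse_one {U2 U1 V : Finset ℤ} {z : ℤ} (h : z ∈ U1) :
    bse U2 U1 V z = 2 - 2 * io (Pay U2 U1 V z) + 3 * io (z + 1 ∉ U1) := by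
  have h1 : z ∉ U2 \ U1 := by simp [h]
  have h2 : ¬ (z ∉ U1 ∪ U2) := by simp [h]
  unfold bse
  rw [io_true h, io_false h1, io_false h2, io_false (p := z ∉ U1 ∪ U2 ∧ _) (fun h => h2 h.1),
    io_false (p := z ∈ U2 \ U1 ∧ _) (fun h => h1 h.1)]
  simp only [h, true_and]
  ring

lemma bse_two {U2 U1 V : Finset ℤ} {z : ℤ} (h : z ∈ U2 \ U1) :
    bse U2 U1 V z = 4 + 3 * io (z + 1 ∉ U2 \ U1) := by
  have h1 : z ∉ U1 := (Finset.mem_sdiff.1 h).2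
  have h2 : ¬ (z ∉ U1 ∪ U2) := by simp [(Finset.mem_sdiff.1 h).1]
  have h3 : ¬ Pay U2 U1 V z := fun h => h1 h.2.1.mem
  unfold bse
  rw [io_true h, io_false h1, io_false h2, io_false (p := z ∉ U1 ∪ U2 ∧ _) (fun h => h2 h.1), io_false h3,
    io_false (p := z ∈ U1 ∧ _) (fun h => h1 h.1)]
  simp only [h, true_and]
  ring

lemma bse_three {U2 U1 V : Finset ℤ} {z : ℤ} (h : z ∉ U1 ∪ U2) :
    bse U2 U1 V z = 6 - 3 * io (z + 1 ∉ V \ (U1 ∪ U2)) := by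
  have h1 : z ∉ U1 := fun h' => h (Finset.mem_union_left _ h')
  have h2 : z ∉ U2 \ U1 := fun h' => h (Finset.mem_union_right _ (Finset.mem_sdiff.1 h').1)
  have h3 : ¬ Pay U2 U1 V z := fun h => h1 h.2.1.mem
  unfold bse
  rw [io_true h, io_false h1, io_false h2, io_false h3, io_false (fun h : _ ∧ _ => h1 h.1),
    io_false (fun h : _ ∧ _ => h2 h.1)]
  simp only [h, true_and, not_false_eq_true]
  ring

lemma tri (U2 U1 : Finset ℤ) (z : ℤ) : z ∈ U1 ∨ z ∈ U2 \ U1 ∨ z ∉ U1 ∪ U2 := by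
  simp only [Finset.mem_sdiff, Finset.mem_union]; tauto

lemma bse_nonneg (U2 U1 V : Finset ℤ) (z : ℤ) : 0 ≤ bse U2 U1 V z := by
  rcases tri U2 U1 z with h | h | h
  · rw [bse_one h]
    have := io_le (Pay U2 U1 V z); have := io_nonneg (z + 1 ∉ U1); omega
  · rw [bse_two h]
    have := io_nonneg (z + 1 ∉ U2 \ U1); omega
  · rw [bse_three h]
    have := io_le (z + 1 ∉ V \ (U1 ∪ U2)); omega

lemma bse_ge3 {U2 U1 V : Finset ℤ} {z : ℤ} (h : z ∉ U1) : 3 ≤ bse U2 U1 V z := by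
  rcases tri U2 U1 z with h' | h | h
  · exact absurd h' h
  · rw [bse_two h]
    have := io_nonneg (z + 1 ∉ U2 \ U1); omega
  · rw [bse_three h]
    have := io_le (z + 1 ∉ V \ (U1 ∪ U2)); omega

lemma bse_one' {U2 U1 V : Finset ℤ} {z : ℤ} (h : z ∈ U1) (h' : z + 1 ∉ U1) :
    3 ≤ bse U2 U1 V z := by
  rw [bse_one h, io_true h']
  have := io_le (Pay U2 U1 V z); omega

lemma bse_one_np {U2 U1 V : Finset ℤ} {z : ℤ} (h : z ∈ U1) (h' : ¬ Pay U2 U1 V z) :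
    2 ≤ bse U2 U1 V z := by
  rw [bse_one h, io_false h']
  have := io_nonneg (z + 1 ∉ U1); omega

lemma bse_one_np' {U2 U1 V : Finset ℤ} {z : ℤ} (h : z ∈ U1) (h' : ¬ Pay U2 U1 V z)
    (h1 : z + 1 ∉ U1) : 5 ≤ bse U2 U1 V z := by
  rw [bse_one h, io_false h', io_true h1]
  omega

lemma bse_two_ge {U2 U1 V : Finset ℤ} {z : ℤ} (h : z ∈ U2 \ U1) : 4 ≤ bse U2 U1 V z := by
  rw [bse_two h]
  have := io_nonneg (z + 1 ∉ U2 \ U1); omega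

lemma bse_two_ge' {U2 U1 V : Finset ℤ} {z : ℤ} (h : z ∈ U2 \ U1) (h' : z + 1 ∉ U2 \ U1) :
    7 ≤ bse U2 U1 V z := by
  rw [bse_two h, io_true h']
  omega

lemma bse_three_ge' {U2 U1 V : Finset ℤ} {z : ℤ} (h : z ∉ U1 ∪ U2)
    (h1 : z + 1 ∈ V) (h2 : z + 1 ∉ U1 ∪ U2) : 6 ≤ bse U2 U1 V z := by
  rw [bse_three h, io_false]
  · omega
  · simp only [Finset.mem_sdiff, not_not]; exact ⟨h1, h2⟩

/-- first transition -/
lemma first_trans (p : ℤ → Prop) {a r : ℤ} (har : a ≤ r) (ha : p a) (hr : ¬ p r) :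
    ∃ z, a ≤ z ∧ z < r ∧ p z ∧ ¬ p (z + 1) := by
  by_contra hcon
  push Not at hcon
  have : ∀ r', a ≤ r' → r' ≤ r → p r' := by
    intro r' h
    induction r', h using Int.leInduction with
    | base => intro _; exact ha
    | succ n hn ih => intro h; exact hcon n hn (by omega) (ih (by omega))
  exact hr (this r har le_rfl)

/-- the run starting at `b` touches U1, or has two consecutive rows of U2 -/
def MB (U2 U1 V : Finset ℤ) (b : ℤ) : Prop :=
  (∃ y, b ≤ y ∧ Finset.Icc b y ⊆ V ∧ y ∈ U1) ∨ Mrg V U2 b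

open Finset in
lemma ngv_sum {U2 U1 V : Finset ℤ} {b t : ℤ} (hbt : b ≤ t) (hI : Icc b t ⊆ V) (hb : b - 1 ∉ V)
    (ht : t + 1 ∉ V) : ∑ z ∈ Icc b t, ngv U2 U1 V z =
      3 + 3 * io (b ∈ U1 ∧ b - 1 ∈ U1) + 3 * io (b ∈ U2 \ U1 ∧ b - 1 ∈ U2 \ U1) := by
  have hV : ∀ z, b ≤ z → z ≤ t → z ∈ V := fun z h1 h2 => hI (mem_Icc.2 ⟨h1, h2⟩)
  unfold ngv
  rw [sum_add_distrib, sum_add_distrib]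
  congr 1
  · congr 1
    · rw [sum_eq_single t]
      · rw [io_true ht]; rfl
      · intro z hz hne
        rw [mem_Icc] at hz
        rw [io_false (not_not.2 (hV _ (by omega) (by omega)))]; rfl
      · intro h; exact absurd (mem_Icc.2 ⟨hbt, le_rfl⟩) h
    · rw [sum_eq_single b]
      · simp [hb]
      · intro z hz hne
        rw [mem_Icc] at hz
        rw [io_false (fun h => h.2.2 (hV _ (by omega) (by omega)))]; rfl
      · intro h; exact absurd (mem_Icc.2 ⟨le_rfl, hbt⟩) h
  · rw [sum_eq_single b]
    · simp [hb]
    · intro z hz hne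
      rw [mem_Icc] at hz
      rw [io_false (fun h => h.2.2 (hV _ (by omega) (by omega)))]; rfl
    · intro h; exact absurd (mem_Icc.2 ⟨le_rfl, hbt⟩) h

open Finset in
lemma per_run {U2 U1 V W : Finset ℤ} (h2 : R3 U2) (h1 : R3 U1) (h0 : R3 V) (hp : Ptn U1 V W)
    {b t : ℤ} (hbt : b ≤ t) (hI : Icc b t ⊆ V) (hb : b - 1 ∉ V) (ht : t + 1 ∉ V) :
    6 * io (¬ Mrg V (U1 ∪ U2) b) + 6 * io (¬ MB U2 U1 V b) ≤
      ∑ z ∈ Icc b t, (bse U2 U1 V z + 2 * io (Pay U1 V W z) - ngv U2 U1 V z) := by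
  have hV : ∀ z, b ≤ z → z ≤ t → z ∈ V := fun z h1 h2 => hI (mem_Icc.2 ⟨h1, h2⟩)
  have hV' : ∀ z, b - 1 ≤ z → z ≤ t + 1 → z ∈ V → b ≤ z ∧ z ≤ t := by
    intro z h1 h2 h3
    have : z ≠ b - 1 := by rintro rfl; exact hb h3
    have : z ≠ t + 1 := by rintro rfl; exact ht h3
    omega
  have ht2 : b + 2 ≤ t := by
    obtain ⟨β, q1, q2, q3, q4, q5⟩ := h0 b (hV b le_rfl hbt)
    have : β ≠ b - 1 := by rintro rfl; exact hb q3
    have : β + 1 ≠ b - 1 := by intro h; rw [h] at q4; exact hb q4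
    have hβ : β = b := by omega
    subst hβ
    have : t ≠ β := by rintro rfl; exact ht q4
    have : t ≠ β + 1 := by rintro rfl; exact ht (by rwa [add_assoc])
    omega
  rw [sum_sub_distrib, ngv_sum hbt hI hb ht]
  set S := ∑ z ∈ Icc b t, (bse U2 U1 V z + 2 * io (Pay U1 V W z)) with hS
  have hnn : ∀ z, 0 ≤ bse U2 U1 V z + 2 * io (Pay U1 V W z) := fun z => by
    have := bse_nonneg U2 U1 V z; have := io_nonneg (Pay U1 V W z); omega
  have hge : ∀ z, bse U2 U1 V z ≤ bse U2 U1 V z + 2 * io (Pay U1 V W z) := fun z => by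
    have := io_nonneg (Pay U1 V W z); omega
  have s1 : ∀ z, b ≤ z → z ≤ t → bse U2 U1 V z ≤ S := by
    intro z hz1 hz2
    exact (hge z).trans (single_le_sum (f := fun z => bse U2 U1 V z + 2 * io (Pay U1 V W z))
      (fun i _ => hnn i) (mem_Icc.2 ⟨hz1, hz2⟩))
  have sT : ∀ T : Finset ℤ, T ⊆ Icc b t →
      ∑ z ∈ T, (bse U2 U1 V z + 2 * io (Pay U1 V W z)) ≤ S := fun T hT =>
    sum_le_sum_of_subset_of_nonneg hT (fun i _ _ => hnn i)
  have s2 : ∀ z w, b ≤ z → z ≤ t → b ≤ w → w ≤ t → z ≠ w →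
      bse U2 U1 V z + bse U2 U1 V w ≤ S := by
    intro z w hz1 hz2 hw1 hw2 hne
    have := sT {z, w} (by
      intro i hi
      simp only [mem_insert, mem_singleton] at hi
      rw [mem_Icc]; omega)
    rw [sum_pair hne] at this
    have := hge z; have := hge w; omega
  have s3 : bse U2 U1 V b + 2 * io (Pay U1 V W b) +
      (bse U2 U1 V (b + 1) + 2 * io (Pay U1 V W (b + 1))) +
      (bse U2 U1 V (b + 2) + 2 * io (Pay U1 V W (b + 2))) ≤ S := by
    have := sT {b, b + 1, b + 2} (by
      intro i hi
      simp only [mem_insert, mem_singleton] at hi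
      rw [mem_Icc]; omega)
    rw [sum_insert (by simp), sum_pair (by omega)] at this
    omega
  have cr1 := io_le (b ∈ U1 ∧ b - 1 ∈ U1)
  have cr2 := io_le (b ∈ U2 \ U1 ∧ b - 1 ∈ U2 \ U1)
  have crU : b ∉ U1 → io (b ∈ U1 ∧ b - 1 ∈ U1) = 0 := fun h => io_false (fun h' => h h'.1)
  have crX : b ∉ U2 \ U1 → io (b ∈ U2 \ U1 ∧ b - 1 ∈ U2 \ U1) = 0 :=
    fun h => io_false (fun h' => h h'.1)
  by_cases hi : ∃ y, b ≤ y ∧ y + 1 ≤ t ∧ y ∈ U1 ∧ y + 1 ∈ U1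
  · obtain ⟨y, y1, y2, y3, y4⟩ := hi
    rw [io_false (p := ¬ Mrg _ _ _) (not_not.2 ⟨y, y1, fun z hz => by
        rw [mem_Icc] at hz; exact hV z hz.1 (by omega), mem_union_left _ y3, mem_union_left _ y4⟩),
      io_false (p := ¬ MB _ _ _ _) (not_not.2 (Or.inl ⟨y, y1, fun z hz => by
        rw [mem_Icc] at hz; exact hV z hz.1 (by omega), y3⟩))]
    by_cases hall : ∀ z, b ≤ z → z ≤ t → z ∈ U1
    · have hX : b ∉ U2 \ U1 := fun h => (mem_sdiff.1 h).2 (hall b le_rfl hbt)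
      rw [crX hX]
      by_cases hext : b - 1 ∈ U1 ∨ t + 1 ∈ U1
      · have hnp : ∀ z, b ≤ z → z ≤ b + 2 → ¬ Pay U2 U1 V z := by
          rintro z z1 z2 ⟨-, ⟨β, q1, q2, q3, q4, q5, q6, q7, -⟩, -⟩
          have c1 : ¬ (b ≤ β - 1 ∧ β - 1 ≤ t) := fun h => q6 (hall _ h.1 h.2)
          have c2 : ¬ (b ≤ β + 3 ∧ β + 3 ≤ t) := fun h => q7 (hall _ h.1 h.2)
          rcases hext with h | h
          · have : β - 1 ≠ b - 1 := fun h' => q6 (h' ▸ h)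
            omega
          · have : β + 3 ≠ t + 1 := fun h' => q7 (h' ▸ h)
            omega
        have e1 := bse_one_np (hall b le_rfl hbt) (hnp b (by omega) (by omega))
        have e2 := bse_one_np (hall (b + 1) (by omega) (by omega)) (hnp (b + 1) (by omega) (by omega))
        have e3 := bse_one_np (hall (b + 2) (by omega) (by omega)) (hnp (b + 2) (by omega) (by omega))
        have := hge b; have := hge (b + 1); have := hge (b + 2)
        omega
      · push Not at hext
        rw [io_false (fun h => hext.1 h.2)]
        have := s1 t hbt le_rfl
        have := bse_one' (V := V) (U2 := U2) (hall t hbt le_rfl) hext.2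
        omega
    · push Not at hall
      obtain ⟨r, r1, r2, r3⟩ := hall
      have e1 := bse_ge3 (U2 := U2) (V := V) r3
      have := s1 r r1 r2
      rcases tri U2 U1 b with h | h | h
      · have hX : b ∉ U2 \ U1 := fun h' => (mem_sdiff.1 h').2 h
        rw [crX hX]
        obtain ⟨z, z1, z2, z3, z4⟩ := first_trans (fun z => z ∈ U1) r1 h r3
        have e2 := bse_one' (V := V) (U2 := U2) z3 z4
        have := s2 z r z1 (by omega) r1 r2 (by omega)
        omega
      · rw [crU (mem_sdiff.1 h).2]
        obtain ⟨z, z1, z2, z3, z4⟩ := first_trans (fun z => z ∈ U2 \ U1) y1 h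
          (fun h' => (mem_sdiff.1 h').2 y3)
        have e2 := bse_two_ge' (V := V) z3 z4
        have := s1 z z1 (by omega)
        omega
      · rw [crU (fun h' => h (mem_union_left _ h')),
          crX (fun h' => h (mem_union_right _ (mem_sdiff.1 h').1))]
        omega
  · push Not at hi
    have hnp : ∀ z, b ≤ z → z ≤ t → ¬ Pay U2 U1 V z := by
      rintro z z1 z2 ⟨-, q, (⟨q1, q2⟩ | ⟨q1, q2⟩)⟩
      · have := hV' _ (by omega) (by omega) q1
        exact hi z z1 (by omega) q.mem q2.mem
      · have := hV' _ (by omega) (by omega) q1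
        exact hi (z - 1) (by omega) (by omega) q2.mem (by simpa using q.mem)
    by_cases hA : Mrg V (U1 ∪ U2) b
    · obtain ⟨y, y1, y2, y3, y4⟩ := hA
      have hyt : y + 1 ≤ t := by
        by_contra hcon
        exact ht (y2 (mem_Icc.2 ⟨by omega, by omega⟩))
      have hB : MB U2 U1 V b := by
        by_cases h : y ∈ U1
        · exact Or.inl ⟨y, y1, fun z hz => y2 (by rw [mem_Icc] at *; omega), h⟩
        by_cases h' : y + 1 ∈ U1
        · exact Or.inl ⟨y + 1, by omega, y2, h'⟩
        · refine Or.inr ⟨y, y1, y2, ?_, ?_⟩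
          · simpa [h] using y3
          · simpa [h'] using y4
      rw [io_false (p := ¬ Mrg _ _ _) (not_not.2 ⟨y, y1, y2, y3, y4⟩),
        io_false (p := ¬ MB _ _ _ _) (not_not.2 hB)]
      obtain ⟨r, r1, r2, r3⟩ : ∃ r, b ≤ r ∧ r ≤ t ∧ r ∈ U2 \ U1 := by
        rw [mem_union] at y3 y4
        by_cases h : y ∈ U1
        · have := hi y y1 hyt h
          exact ⟨y + 1, by omega, by omega, mem_sdiff.2 ⟨by tauto, this⟩⟩
        · exact ⟨y, by omega, by omega, mem_sdiff.2 ⟨by tauto, h⟩⟩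
      have e1 := bse_two_ge (V := V) r3
      have := s1 r r1 r2
      by_cases h : b ∈ U1
      · have hX : b ∉ U2 \ U1 := fun h' => (mem_sdiff.1 h').2 h
        rw [crX hX]
        have := bse_one_np' (U2 := U2) h (hnp b le_rfl hbt) (hi b le_rfl (by omega) h)
        have := s2 b r le_rfl hbt r1 r2 (by rintro rfl; exact (mem_sdiff.1 r3).2 h)
        omega
      · rw [crU h]
        by_cases hX : b ∈ U2 \ U1
        · by_cases hX1 : b + 1 ∈ U2 \ U1
          · have := bse_two_ge (V := V) hX
            have := bse_two_ge (V := V) hX1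
            have := s2 b (b + 1) le_rfl hbt (by omega) (by omega) (by omega)
            omega
          · have := bse_two_ge' (V := V) hX hX1
            have := s1 b le_rfl hbt
            omega
        · rw [crX hX]
          omega
    · rw [io_true hA]
      have hMM : ∀ y, b ≤ y → y + 1 ≤ t → ¬ (y ∈ U1 ∪ U2 ∧ y + 1 ∈ U1 ∪ U2) := by
        rintro y y1 y2 ⟨y3, y4⟩
        exact hA ⟨y, y1, fun z hz => by rw [mem_Icc] at hz; exact hV z hz.1 (by omega), y3, y4⟩
      have nb : ∀ U, R3 U → ∀ z ∈ U, z + 1 ∈ U ∨ z - 1 ∈ U := by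
        intro U hU z hz
        obtain ⟨β, q1, q2, q3, q4, q5⟩ := hU z hz
        have : z = β ∨ z = β + 1 ∨ z = β + 2 := by omega
        rcases this with rfl | rfl | rfl
        · exact Or.inl q4
        · right; simpa using q3
        · right; convert q4 using 1; ring
      have hint : ∀ z, b < z → z < t → z ∉ U1 ∪ U2 := by
        intro z z1 z2 hz
        have : z + 1 ∈ U1 ∪ U2 ∨ z - 1 ∈ U1 ∪ U2 := by
          rw [mem_union] at hz
          rcases hz with h | h
          · exact (nb U1 h1 z h).imp (mem_union_left _) (mem_union_left _)
          · exact (nb U2 h2 z h).imp (mem_union_right _) (mem_union_right _)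
        rcases this with h | h
        · exact hMM z (by omega) (by omega) ⟨hz, h⟩
        · exact hMM (z - 1) (by omega) (by omega) ⟨h, by simpa using hz⟩
      have hb1L := hint (b + 1) (by omega) (by omega)
      have ht1L := hint (t - 1) (by omega) (by omega)
      have hb1U : b + 1 ∉ U1 := fun h => hb1L (mem_union_left _ h)
      have hb1X : b + 1 ∉ U2 \ U1 := fun h => hb1L (mem_union_right _ (mem_sdiff.1 h).1)
      -- last two rows
      have last2 : (t ∈ U1 ∧ 5 ≤ bse U2 U1 V (t - 1) + bse U2 U1 V t) ∨
          (t ∉ U1 ∧ 7 ≤ bse U2 U1 V (t - 1) + bse U2 U1 V t) := by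
        have e0 := bse_ge3 (U2 := U2) (V := V) (fun h => ht1L (mem_union_left _ h))
        rcases tri U2 U1 t with h | h | h
        · left
          have := bse_one_np (U2 := U2) h (hnp t hbt le_rfl)
          exact ⟨h, by omega⟩
        · right
          have := bse_two_ge (V := V) h
          exact ⟨(mem_sdiff.1 h).2, by omega⟩
        · right
          have hU : t ∉ U1 := fun h' => h (mem_union_left _ h')
          have e1 := bse_three_ge' (V := V) ht1L (by simpa using hV t hbt le_rfl) (by simpa using h)
          have := bse_ge3 (U2 := U2) (V := V) hU
          exact ⟨hU, by omega⟩
      -- first row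
      have first : (b ∈ U1 ∧ b ∉ U2 \ U1 ∧ 5 ≤ bse U2 U1 V b) ∨
          (b ∉ U1 ∧ 7 ≤ bse U2 U1 V b) ∨
          (b ∉ U1 ∧ b ∉ U2 \ U1 ∧ 6 ≤ bse U2 U1 V b) := by
        rcases tri U2 U1 b with h | h | h
        · exact Or.inl ⟨h, fun h' => (mem_sdiff.1 h').2 h, bse_one_np' h (hnp b le_rfl hbt) hb1U⟩
        · exact Or.inr (Or.inl ⟨(mem_sdiff.1 h).2, bse_two_ge' h hb1X⟩)
        · exact Or.inr (Or.inr ⟨fun h' => h (mem_union_left _ h'),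
            fun h' => h (mem_union_right _ (mem_sdiff.1 h').1),
            bse_three_ge' h (hV _ (by omega) (by omega)) hb1L⟩)
      have hKB : b ∈ U1 ∨ t ∈ U1 → io (¬ MB U2 U1 V b) = 0 := by
        rintro (h | h)
        · exact io_false (not_not.2 (Or.inl ⟨b, le_rfl, fun z hz => by
            rw [mem_Icc] at hz; exact hV z hz.1 (by omega), h⟩))
        · exact io_false (not_not.2 (Or.inl ⟨t, hbt, hI, h⟩))
      have hKB1 := io_le (¬ MB U2 U1 V b)
      have bonus : bse U2 U1 V b + (bse U2 U1 V (t - 1) + bse U2 U1 V t) + 4 ≤ S := by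
        rcases eq_or_lt_of_le ht2 with h | h
        · -- h = 3
          have et : t - 1 = b + 1 := by omega
          have et3 : b + 3 ∉ V := by
            have e3 : b + 3 = t + 1 := by omega
            rw [e3]; exact ht
          have hbV := hV b le_rfl hbt
          have hbV1 := hV (b + 1) (by omega) (by omega)
          have hbV2 := hV (b + 2) (by omega) (by omega)
          have hDl : ∀ z, b ≤ z → z ≤ b + 2 → Dl V U1 z := by
            intro z z1 z2
            exact ⟨b, z1, z2, hbV, hbV1, hbV2, hb, et3,
              fun h => hb1U h.2, fun h => hb1U h.1⟩
          obtain ⟨y, y1, y2, hy⟩ := hp b hbV hbV1 hbV2 hb et3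
          have hW : y ∈ W ∧ y + 1 ∈ W := by
            rcases hy with h' | h'
            · exact absurd h'.2 (hi y y1 (by omega) h'.1)
            · exact h'
          have p1 : Pay U1 V W y := ⟨hW.1, hDl _ (by omega) (by omega),
            Or.inl ⟨hW.2, hDl _ (by omega) (by omega)⟩⟩
          have p2 : Pay U1 V W (y + 1) := ⟨hW.2, hDl _ (by omega) (by omega),
            Or.inr ⟨by simpa using hW.1, hDl _ (by omega) (by omega)⟩⟩
          have i0 := io_nonneg (Pay U1 V W b)
          have i2 := io_nonneg (Pay U1 V W (b + 2))
          rw [et, ← h]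
          have hy' : y = b ∨ y = b + 1 := by omega
          rcases hy' with rfl | rfl
          · rw [io_true p1, io_true p2] at s3
            omega
          · have e2 : b + 1 + 1 = b + 2 := by ring
            rw [e2] at p2
            rw [io_true p1, io_true p2] at s3
            omega
        · have := sT {b, b + 1, t - 1, t} (by
            intro i hi
            simp only [mem_insert, mem_singleton] at hi
            rw [mem_Icc]; omega)
          rw [sum_insert (by simp; omega), sum_insert (by simp; omega), sum_pair (by omega)] at this
          have := hge b; have := hge (b + 1); have := hge (t - 1); have := hge t
          have e1 := bse_three_ge' (V := V) hb1L (hV _ (by omega) (by omega))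
            (hint (b + 1 + 1) (by omega) (by omega))
          omega
      rcases last2 with ⟨g1, g2⟩ | ⟨g1, g2⟩
      · rw [hKB (Or.inr g1)]
        rcases first with ⟨f1, f2, f3⟩ | ⟨f1, f3⟩ | ⟨f1, f2, f3⟩
        · rw [crX f2]; omega
        · rw [crU f1]; omega
        · rw [crU f1]; omega
      · rcases first with ⟨f1, f2, f3⟩ | ⟨f1, f3⟩ | ⟨f1, f2, f3⟩
        · rw [hKB (Or.inl f1), crX f2]; omega
        · rw [crU f1]; omega
        · rw [crU f1, crX f2]; omega

open Finset in
lemma card_io (S : Finset ℤ) (p : ℤ → Prop) [DecidablePred p] : ((S.filter p).card : ℤ) = ∑ z ∈ S, io (p z) := by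
  rw [card_filter]
  push_cast
  refine sum_congr rfl fun z _ => ?_
  by_cases h : p z <;> simp [io, h]

open Finset in
lemma sum_runs (V : Finset ℤ) (f c : ℤ → ℤ)
    (h : ∀ b t, b ≤ t → Icc b t ⊆ V → b - 1 ∉ V → t + 1 ∉ V → c b ≤ ∑ z ∈ Icc b t, f z) :
    ∑ b ∈ V.filter (fun b => b - 1 ∉ V), c b ≤ ∑ z ∈ V, f z := by
  refine runs_induction' V (fun D' => ∑ b ∈ D'.filter (fun b => b - 1 ∉ V), c b ≤ ∑ z ∈ D', f z)
    (by simp) ?_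
  intro D' b t hbt hD' hI hb ht hlt ih
  have hdis : Disjoint D' (Icc b t) := by
    rw [disjoint_left]
    intro z hz hz'
    have := hlt z hz
    rw [mem_Icc] at hz'
    omega
  rw [filter_union, sum_union hdis, sum_union (disjoint_filter_filter hdis)]
  have : (Icc b t).filter (fun b => b - 1 ∉ V) = {b} := by
    ext z
    rw [mem_filter, mem_Icc, mem_singleton]
    constructor
    · rintro ⟨h1, h2⟩
      by_contra hne
      exact h2 (hI (mem_Icc.2 ⟨by omega, by omega⟩))
    · rintro rfl
      exact ⟨⟨le_rfl, hbt⟩, hb⟩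
  rw [this, sum_singleton]
  exact add_le_add ih (h b t hbt hI hb ht)

open Classical in
noncomputable def NB (U2 U1 V : Finset ℤ) : ℕ :=
  (V.filter (fun b => b - 1 ∉ V ∧ ¬ MB U2 U1 V b)).card

open Finset in
lemma nr_id (A V : Finset ℤ) : (nr (A \ V) : ℤ) + ∑ z ∈ V, io (z ∈ A ∧ z + 1 ∉ A) =
    nr A + ∑ z ∈ V, io (z ∈ A ∧ z - 1 ∈ A ∧ z - 1 ∉ V) := by
  classical
  rw [← card_io, ← card_io]
  unfold nr
  have e1 : (A \ V).filter (fun y => y + 1 ∉ A \ V) =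
      ((A \ V).filter (fun y => y + 1 ∉ A)) ∪ ((A \ V).filter (fun y => y + 1 ∈ A ∧ y + 1 ∈ V)) := by
    ext z; simp only [mem_filter, mem_union, mem_sdiff]; tauto
  have e2 : A.filter (fun y => y + 1 ∉ A) =
      ((A \ V).filter (fun y => y + 1 ∉ A)) ∪ (V.filter (fun z => z ∈ A ∧ z + 1 ∉ A)) := by
    ext z; simp only [mem_filter, mem_union, mem_sdiff]; tauto
  rw [e1, e2, card_union_of_disjoint, card_union_of_disjoint]
  · have : ((A \ V).filter (fun y => y + 1 ∈ A ∧ y + 1 ∈ V)).card =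
        (V.filter (fun z => z ∈ A ∧ z - 1 ∈ A ∧ z - 1 ∉ V)).card := by
      refine card_nbij' (fun z => z + 1) (fun z => z - 1) ?_ ?_ ?_ ?_
      · intro z hz
        simp only [coe_filter, mem_sdiff, Set.mem_ofPred_eq, add_sub_cancel_right] at hz ⊢
        tauto
      · intro z hz
        simp only [coe_filter, mem_sdiff, Set.mem_ofPred_eq, sub_add_cancel] at hz ⊢
        tauto
      · intro z _; simp
      · intro z _; simp
    rw [this]
    push_cast
    ring
  · rw [disjoint_left]
    intro z hz hz'
    simp only [mem_filter, mem_sdiff] at hz hz'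
    tauto
  · rw [disjoint_left]
    intro z hz hz'
    simp only [mem_filter, mem_sdiff] at hz hz'
    tauto

open Finset in
lemma stage_ineq {U2 U1 V W : Finset ℤ} (h2 : R3 U2) (h1 : R3 U1) (h0 : R3 V) (hp : Ptn U1 V W) :
    6 * (NN V (U1 ∪ U2) : ℤ) + 6 * NB U2 U1 V + 3 * nr (V \ (U1 ∪ U2)) + 3 * nr V +
      3 * nr (U1 \ V) + 3 * nr ((U2 \ U1) \ V) + 2 * ∑ z ∈ V, io (Pay U2 U1 V z) ≤
    3 * nr U1 + 3 * nr (U2 \ U1) + 2 * ∑ z ∈ V, io (z ∈ U1) + 4 * ∑ z ∈ V, io (z ∈ U2 \ U1) +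
      6 * ∑ z ∈ V, io (z ∉ U1 ∪ U2) + 2 * ∑ z ∈ V, io (Pay U1 V W z) := by
  classical
  have key := sum_runs V (fun z => bse U2 U1 V z + 2 * io (Pay U1 V W z) - ngv U2 U1 V z)
    (fun b => 6 * io (¬ Mrg V (U1 ∪ U2) b) + 6 * io (¬ MB U2 U1 V b))
    (fun b t hbt hI hb ht => per_run h2 h1 h0 hp hbt hI hb ht)
  have a1 := nr_id U1 V
  have a2 := nr_id (U2 \ U1) V
  have a3 : (NN V (U1 ∪ U2) : ℤ) =
      ∑ b ∈ V.filter (fun b => b - 1 ∉ V), io (¬ Mrg V (U1 ∪ U2) b) := by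
    rw [← card_io, filter_filter]
    unfold NN
    congr 1
  have a4 : (NB U2 U1 V : ℤ) =
      ∑ b ∈ V.filter (fun b => b - 1 ∉ V), io (¬ MB U2 U1 V b) := by
    rw [← card_io, filter_filter]
    unfold NB
    congr 1
  have a5 : (nr (V \ (U1 ∪ U2)) : ℤ) = ∑ z ∈ V, io (z ∉ U1 ∪ U2 ∧ z + 1 ∉ V \ (U1 ∪ U2)) := by
    rw [← card_io]
    unfold nr
    congr 1
    apply congrArg Finset.card
    ext z
    simp only [mem_filter, mem_sdiff]
    tauto
  have a6 : (nr V : ℤ) = ∑ z ∈ V, io (z + 1 ∉ V) := by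
    rw [← card_io]
    rfl
  unfold bse ngv at key
  simp only [sum_add_distrib, sum_sub_distrib, ← mul_sum] at key
  rw [← a3, ← a4, ← a5, ← a6] at key
  linarith

open Finset in
lemma NN_le (U3 U2 U1 V : Finset ℤ) :
    NN (V ∪ U1) (U2 ∪ U3) ≤ NN U1 (U2 ∪ U3) + NB U2 U1 V := by
  classical
  set D := V ∪ U1 with hD
  set M := U2 ∪ U3 with hM
  set p : ℤ → Prop := fun d => ∃ y, d ≤ y ∧ Icc d y ⊆ D ∧ y ∈ U1 with hpdef
  have hex : ∀ d, d - 1 ∉ D → p d → ∃ e, d ≤ e ∧ Icc d e ⊆ D ∧ e ∈ U1 ∧ e - 1 ∉ U1 := by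
    rintro d hd ⟨y, y1, y2, y3⟩
    have hF : (U1.filter (fun e => d ≤ e ∧ Icc d e ⊆ D)).Nonempty :=
      ⟨y, mem_filter.2 ⟨y3, y1, y2⟩⟩
    set e := (U1.filter (fun e => d ≤ e ∧ Icc d e ⊆ D)).min' hF with he
    have hm := (U1.filter (fun e => d ≤ e ∧ Icc d e ⊆ D)).min'_mem hF
    rw [← he, mem_filter] at hm
    refine ⟨e, hm.2.1, hm.2.2, hm.1, ?_⟩
    intro h
    rcases eq_or_lt_of_le hm.2.1 with h' | h'
    · exact hd (mem_union_right _ (h' ▸ h))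
    · have := min'_le (U1.filter (fun e => d ≤ e ∧ Icc d e ⊆ D)) (e - 1) (mem_filter.2 ⟨h, by omega,
        fun z hz => hm.2.2 (by rw [mem_Icc] at *; omega)⟩)
      rw [← he] at this
      omega
  choose! e he using hex
  unfold NN NB
  rw [← card_filter_add_card_filter_not (s := D.filter (fun b => b - 1 ∉ D ∧ ¬ Mrg D M b)) p]
  refine add_le_add ?_ ?_
  · refine card_le_card_of_injOn e ?_ ?_
    · intro d hd
      simp only [coe_filter, mem_filter, Set.mem_ofPred_eq] at hd ⊢
      obtain ⟨⟨d1, d2, d3⟩, d4⟩ := hd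
      obtain ⟨e1, e2, e3, e4⟩ := he d d2 d4
      refine ⟨e3, e4, ?_⟩
      rintro ⟨y, y1, y2, y3, y4⟩
      refine d3 ⟨y, by omega, ?_, y3, y4⟩
      intro z hz
      rw [mem_Icc] at hz
      by_cases h : z ≤ e d
      · exact e2 (mem_Icc.2 ⟨hz.1, h⟩)
      · exact mem_union_right _ (y2 (mem_Icc.2 ⟨by omega, hz.2⟩))
    · intro d hd d' hd' hee
      simp only [coe_filter, mem_filter, Set.mem_ofPred_eq] at hd hd'
      obtain ⟨⟨d1, d2, d3⟩, d4⟩ := hd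
      obtain ⟨e1, e2, e3, e4⟩ := he d d2 d4
      obtain ⟨⟨d1', d2', d3'⟩, d4'⟩ := hd'
      obtain ⟨e1', e2', e3', e4'⟩ := he d' d2' d4'
      rcases lt_trichotomy d d' with h | h | h
      · exact absurd (e2 (mem_Icc.2 ⟨by omega, by omega⟩)) d2'
      · exact h
      · exact absurd (e2' (mem_Icc.2 ⟨by omega, by omega⟩)) d2
  · apply card_le_card
    intro d hd
    simp only [mem_filter] at hd ⊢
    obtain ⟨⟨d1, d2, d3⟩, d4⟩ := hd
    have hdV : d ∈ V := by
      rcases mem_union.1 d1 with h | h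
      · exact h
      · exact absurd ⟨d, le_rfl, by simpa using d1, h⟩ d4
    refine ⟨hdV, fun h => d2 (mem_union_left _ h), ?_⟩
    rintro (⟨y, y1, y2, y3⟩ | ⟨y, y1, y2, y3, y4⟩)
    · exact d4 ⟨y, y1, y2.trans subset_union_left, y3⟩
    · exact d3 ⟨y, y1, y2.trans subset_union_left, mem_union_left _ y3, mem_union_left _ y4⟩

def COL (G : ℤ → Finset ℤ) (x : ℤ) : Finset ℤ := G x ∪ (G (x - 1) ∪ G (x - 2))

noncomputable def Pot (G : ℤ → Finset ℤ) (x : ℤ) : ℤ :=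
  3 * nr (G (x - 1)) + 3 * nr (G (x - 2) \ G (x - 1)) -
    2 * ∑ z ∈ G x, io (Pay (G (x - 2)) (G (x - 1)) (G x) z) -
    2 * ((G (x - 1) ∪ G (x - 2)).card : ℤ) - 2 * ((G (x - 1)).card : ℤ)

open Finset in
lemma pot_step {G : ℤ → Finset ℤ} (h3 : ∀ x, R3 (G x))
    (hp : ∀ x, Ptn (G (x - 1)) (G x) (G (x + 1))) (x : ℤ) :
    6 * (NN (G x) (G (x - 1) ∪ G (x - 2)) : ℤ) + 6 * NB (G (x - 2)) (G (x - 1)) (G x) +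
      3 * nr (LL G x) + 3 * nr (RR G x) + Pot G (x + 1) ≤ 2 * (COL G x).card + Pot G x := by
  classical
  have key := stage_ineq (h3 (x - 2)) (h3 (x - 1)) (h3 x) (hp x)
  have a4 : x + 1 - 1 = x := by ring
  have a5 : x + 1 - 2 = x - 1 := by ring
  unfold Pot LL RR COL
  rw [a4, a5]
  generalize G (x - 2) = U2 at *
  generalize G (x - 1) = U1 at *
  generalize G x = V at *
  generalize G (x + 1) = W at *
  have e1 : U2 \ (U1 ∪ V) = (U2 \ U1) \ V := by
    ext z; simp only [mem_sdiff, mem_union]; tauto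
  have e2 : ∑ z ∈ W, io (Pay U1 V W z) = ∑ z ∈ V, io (Pay U1 V W z) := by
    rw [← card_io, ← card_io]
    congr 1
    apply congrArg Finset.card
    ext z
    simp only [mem_filter]
    constructor
    · rintro ⟨-, h⟩; exact ⟨h.2.1.mem, h⟩
    · rintro ⟨-, h⟩; exact ⟨h.1, h⟩
  have c1 : ((V ∪ (U1 ∪ U2)).card : ℤ) = (U1 ∪ U2).card + ∑ z ∈ V, io (z ∉ U1 ∪ U2) := by
    rw [← card_io]
    norm_cast
    rw [← card_union_of_disjoint]
    · apply congrArg Finset.card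
      ext z; simp only [mem_filter, mem_union]; tauto
    · rw [disjoint_left]; intro z hz; simp only [mem_filter]; tauto
  have c2 : ((V ∪ U1).card : ℤ) = U1.card + ∑ z ∈ V, io (z ∉ U1) := by
    rw [← card_io]
    norm_cast
    rw [← card_union_of_disjoint]
    · apply congrArg Finset.card
      ext z; simp only [mem_filter, mem_union]; tauto
    · rw [disjoint_left]; intro z hz; simp only [mem_filter]; tauto
  have c3 : (V.card : ℤ) = ∑ z ∈ V, io (z ∈ U1) + ∑ z ∈ V, io (z ∉ U1) := by
    rw [← sum_add_distrib, card_eq_sum_ones]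
    push_cast
    refine sum_congr rfl fun z _ => ?_
    by_cases h : z ∈ U1
    · rw [io_true h, io_false (not_not.2 h)]; rfl
    · rw [io_false h, io_true h]; rfl
  have c4 : ∑ z ∈ V, io (z ∉ U1) = ∑ z ∈ V, io (z ∈ U2 \ U1) + ∑ z ∈ V, io (z ∉ U1 ∪ U2) := by
    rw [← sum_add_distrib]
    refine sum_congr rfl fun z _ => ?_
    by_cases h : z ∈ U1 <;> by_cases h' : z ∈ U2 <;> simp [io, h, h']
  rw [e1, e2]
  linarith

open Finset in
lemma total {G : ℤ → Finset ℤ} (h3 : ∀ x, R3 (G x))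
    (hp : ∀ x, Ptn (G (x - 1)) (G x) (G (x + 1))) (a : ℤ) (h0 : ∀ x < a, G x = ∅) (n : ℕ) :
    3 * ∑ k ∈ range n, (cost G (a + k) : ℤ) + Pot G (a + n) +
      6 * NN (G (a + n - 1)) (G (a + n - 2) ∪ G (a + n - 3)) + 3 * nr (LL G (a + n - 1)) +
      3 * (COL G (a + n - 1)).card ≤
    8 * ∑ k ∈ range n, ((COL G (a + k)).card : ℤ) + 3 * (DD G (a + n - 1)).card +
      3 * (DD G (a + n - 2)).card := by
  induction n with
  | zero =>
    have e : ∀ k : ℤ, 0 < k → G (a - k) = ∅ := fun k hk => h0 _ (by omega)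
    have e1 := e 1 (by norm_num)
    have e2 := e 2 (by norm_num)
    have e3 := e 3 (by norm_num)
    have i1 : a - 1 - 1 = a - 2 := by ring
    have i2 : a - 1 - 2 = a - 3 := by ring
    have i3 : a - 2 - 1 = a - 3 := by ring
    have hS : 0 ≤ ∑ z ∈ G a, io (Pay ∅ ∅ (G a) z) := sum_nonneg fun z _ => io_nonneg _
    simp only [Nat.cast_zero, add_zero, range_zero, sum_empty, Pot, LL, COL, DD, i1, i2, i3, e1, e2,
      e3, NN, nr]
    simp
    exact hS
  | succ n ih =>
    have st := pot_step h3 hp (a + n)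
    set x := a + (n : ℤ) with hx
    have j0 : a + ((n + 1 : ℕ) : ℤ) = x + 1 := by push_cast; ring
    have j1 : x + 1 - 1 = x := by ring
    have j2 : x + 1 - 2 = x - 1 := by ring
    have j3 : x + 1 - 3 = x - 2 := by ring
    have i1 : x - 1 - 1 = x - 2 := by ring
    have i2 : x - 1 - 2 = x - 3 := by ring
    have i3 : x - 2 - 1 = x - 3 := by ring
    rw [sum_range_succ, sum_range_succ, j0, j1, j2, j3, ← hx]
    have hN := NN_le (G (x - 3)) (G (x - 2)) (G (x - 1)) (G x)
    have hc1 : (COL G x).card = (DD G x).card + (RR G x).card := by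
      rw [← card_union_of_disjoint]
      · congr 1
        ext z; simp only [COL, DD, RR, mem_union, mem_sdiff]; tauto
      · rw [disjoint_left]; intro z; simp only [DD, RR, mem_union, mem_sdiff]; tauto
    have hc2 : (COL G (x - 1)).card = (DD G (x - 2)).card + (LL G (x - 1)).card := by
      rw [← card_union_of_disjoint]
      · congr 1
        ext z; simp only [COL, DD, LL, mem_union, mem_sdiff, i1, i2, i3]; tauto
      · rw [disjoint_left]; intro z; simp only [DD, LL, mem_union, mem_sdiff, i1, i2, i3]; tauto
    have hcost : (cost G x : ℤ) = 2 * (DD G x).card + 2 * NN (G x ∪ G (x - 1)) (G (x - 2) ∪ G (x - 3))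
        + ((RR G x).card + nr (RR G x)) + ((LL G (x - 1)).card + nr (LL G (x - 1))) := by
      unfold cost
      push_cast
      simp only [DD, i3]
    zify at hN hc1 hc2
    rw [hcost]
    linarith

lemma mem_touchNbrs {c d : Cell} : c ∈ touchNbrs d ↔
    c ≠ d ∧ c.1 ≤ d.1 + 1 ∧ d.1 ≤ c.1 + 1 ∧ c.2 ≤ d.2 + 1 ∧ d.2 ≤ c.2 + 1 := by
  rcases c with ⟨a, b⟩
  rcases d with ⟨e, f⟩
  simp only [touchNbrs, Finset.mem_insert, Finset.mem_singleton, Prod.mk.injEq, ne_eq]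
  omega

lemma offset_sub (S : Finset Cell) : offset S ⊆ S := Finset.filter_subset _ _

lemma offset_mono {S T : Finset Cell} (h : S ⊆ T) : offset S ⊆ offset T := by
  intro c hc
  rw [offset, Finset.mem_filter] at *
  exact ⟨h hc.1, hc.2.trans h⟩

lemma narrow_of {P : Finset Cell} {c : Cell} (hc : c ∈ P)
    (h : ∀ m ∈ offset P, c ∉ touchNbrs m) : IsNarrowPassageCell P c := by
  have hsub : ∀ l : ℕ, offset^[l] P ⊆ P := by
    intro l
    induction l with
    | zero => exact Finset.Subset.refl _
    | succ l ih => rw [Function.iterate_succ_apply']; exact (offset_sub _).trans ih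
  have key : ∀ l : ℕ, offset^[l] (P.erase c) = (offset^[l] P).erase c := by
    intro l
    induction l with
    | zero => rfl
    | succ l ih =>
      rw [Function.iterate_succ_apply', Function.iterate_succ_apply', ih]
      ext d
      rw [offset, Finset.mem_filter, Finset.mem_erase, Finset.mem_erase]
      constructor
      · rintro ⟨⟨h1, h2⟩, h3⟩
        refine ⟨h1, ?_⟩
        rw [offset, Finset.mem_filter]
        exact ⟨h2, h3.trans (Finset.erase_subset _ _)⟩
      · rintro ⟨h1, h2⟩
        have h3 := h d (offset_mono (hsub l) h2)
        rw [offset, Finset.mem_filter] at h2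
        refine ⟨⟨h1, h2.1⟩, ?_⟩
        intro e he
        refine Finset.mem_erase.2 ⟨?_, h2.2 he⟩
        rintro rfl
        exact h3 he
  refine ⟨hc, fun d hd => ?_⟩
  unfold layerNum
  congr 1
  ext l
  have hdc := Finset.ne_of_mem_erase hd
  simp only [Set.mem_ofPred_eq, key, Finset.mem_erase]
  tauto

def Sq (P : Finset Cell) (a b : ℤ) : Prop :=
  ∀ x y : ℤ, a ≤ x → x ≤ a + 2 → b ≤ y → y ≤ b + 2 → (x, y) ∈ P

lemma center {P : Finset Cell} (hnp : ∀ c ∈ P, ¬ IsNarrowPassageCell P c) {x y : ℤ}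
    (h : (x, y) ∈ P) : ∃ a b, Sq P a b ∧ a ≤ x ∧ x ≤ a + 2 ∧ b ≤ y ∧ y ≤ b + 2 ∧
      ¬ (x = a + 1 ∧ y = b + 1) := by
  by_contra hcon
  refine hnp _ h (narrow_of h ?_)
  rintro ⟨p, q⟩ hm hc
  rw [mem_touchNbrs] at hc
  simp only [ne_eq, Prod.mk.injEq] at hc
  refine hcon ⟨p - 1, q - 1, ?_, by omega, by omega, by omega, by omega, by omega⟩
  intro u v u1 u2 v1 v2
  rw [offset, Finset.mem_filter] at hm
  by_cases he : u = p ∧ v = q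
  · rw [he.1, he.2]; exact hm.1
  · apply hm.2
    rw [mem_touchNbrs]
    simp only [ne_eq, Prod.mk.injEq]
    omega

open Classical in
noncomputable def GG (P : Finset Cell) (a : ℤ) : Finset ℤ :=
  (P.image Prod.snd).filter (fun y => ∃ b, b ≤ y ∧ y ≤ b + 2 ∧ Sq P a b)

lemma mem_GG {P : Finset Cell} {a y : ℤ} : y ∈ GG P a ↔ ∃ b, b ≤ y ∧ y ≤ b + 2 ∧ Sq P a b := by
  classical
  unfold GG
  simp only [Finset.mem_filter, Finset.mem_image]
  constructor
  · exact fun h => h.2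
  · intro h
    refine ⟨?_, h⟩
    obtain ⟨b, h1, h2, h3⟩ := h
    exact ⟨(a, y), h3 a y le_rfl (by omega) h1 h2, rfl⟩

lemma GG_R3 (P : Finset Cell) (a : ℤ) : R3 (GG P a) := by
  intro y hy
  rw [mem_GG] at hy
  obtain ⟨b, h1, h2, h3⟩ := hy
  refine ⟨b, h1, h2, ?_, ?_, ?_⟩ <;> rw [mem_GG] <;> exact ⟨b, by omega, by omega, h3⟩

lemma GG_mem {P : Finset Cell} (hnp : ∀ c ∈ P, ¬ IsNarrowPassageCell P c) (x y : ℤ) :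
    (x, y) ∈ P ↔ y ∈ GG P x ∨ y ∈ GG P (x - 1) ∨ y ∈ GG P (x - 2) := by
  constructor
  · intro h
    obtain ⟨a, b, hs, h1, h2, h3, h4, -⟩ := center hnp h
    simp only [mem_GG]
    have : a = x ∨ a = x - 1 ∨ a = x - 2 := by omega
    rcases this with rfl | rfl | rfl
    · exact Or.inl ⟨b, h3, h4, hs⟩
    · exact Or.inr (Or.inl ⟨b, h3, h4, hs⟩)
    · exact Or.inr (Or.inr ⟨b, h3, h4, hs⟩)
  · simp only [mem_GG]
    rintro (⟨b, h1, h2, hs⟩ | ⟨b, h1, h2, hs⟩ | ⟨b, h1, h2, hs⟩) <;>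
      exact hs _ _ (by omega) (by omega) h1 h2

lemma GG_Ptn {P : Finset Cell} (hnp : ∀ c ∈ P, ¬ IsNarrowPassageCell P c) (a : ℤ) :
    Ptn (GG P (a - 1)) (GG P a) (GG P (a + 1)) := by
  intro b h1 h2 h3 h4 h5
  have hs : Sq P a b := by
    rw [mem_GG] at h1
    obtain ⟨β, q1, q2, q3⟩ := h1
    have : ¬ (β < b) := fun h => h4 (mem_GG.2 ⟨β, by omega, by omega, q3⟩)
    have : β = b := by omega
    exact this ▸ q3
  obtain ⟨p, q, hs', g1, g2, g3, g4, g5⟩ :=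
    center hnp (hs (a + 1) (b + 1) (by omega) (by omega) (by omega) (by omega))
  have hpa : p ≠ a := by
    rintro rfl
    have : q = b - 1 ∨ q = b + 1 := by omega
    rcases this with rfl | rfl
    · exact h4 (mem_GG.2 ⟨b - 1, by omega, by omega, hs'⟩)
    · exact h5 (mem_GG.2 ⟨b + 1, by omega, by omega, hs'⟩)
  have hex : ∃ y, b ≤ y ∧ y ≤ b + 1 ∧ q ≤ y ∧ y + 1 ≤ q + 2 := by
    by_cases h : q ≤ b
    · exact ⟨b, by omega, by omega, by omega, by omega⟩
    · exact ⟨b + 1, by omega, by omega, by omega, by omega⟩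
  obtain ⟨y, y1, y2, y3, y4⟩ := hex
  refine ⟨y, y1, y2, ?_⟩
  simp only [mem_GG]
  have : p = a - 1 ∨ p = a + 1 := by omega
  rcases this with rfl | rfl
  · exact Or.inl ⟨⟨q, by omega, by omega, hs'⟩, ⟨q, by omega, by omega, hs'⟩⟩
  · exact Or.inr ⟨⟨q, by omega, by omega, hs'⟩, ⟨q, by omega, by omega, hs'⟩⟩

lemma sum_parity (f : ℕ → ℕ) (n : ℕ) : ∑ k ∈ Finset.range (2 * n), f k =
    ∑ k ∈ Finset.range n, f (2 * k) + ∑ k ∈ Finset.range n, f (2 * k + 1) := by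
  induction n with
  | zero => simp
  | succ n ih =>
    rw [Nat.mul_succ, Finset.sum_range_succ, Finset.sum_range_succ, Finset.sum_range_succ,
      Finset.sum_range_succ, ih]
    ring

lemma short_tour (P : Finset Cell) (hP : GridPolygon P)
    (hnp : ∀ c ∈ P, ¬ IsNarrowPassageCell P c) :
    ∃ y : CWalk P, 3 * (y.2.length + 2) ≤ 4 * P.card ∧ (∀ c, c ∈ P ↔ c ∈ y.2.support) := by
  have hG := GG_mem hnp
  have h3 := GG_R3 P
  have hp := GG_Ptn hnp
  generalize GG P = G at hG h3 hp
  obtain ⟨B, hB⟩ : ∃ B : ℕ, ∀ c ∈ P, -(B : ℤ) < c.1 ∧ c.1 < B := by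
    refine ⟨P.sup (fun c => c.1.natAbs) + 1, fun c hc => ?_⟩
    have := Finset.le_sup (f := fun c : Cell => c.1.natAbs) hc
    push_cast
    omega
  have hlo : ∀ x : ℤ, x < -(B : ℤ) + 1 → G x = ∅ := by
    intro x hx
    rw [Finset.eq_empty_iff_forall_notMem]
    intro y hy
    have := hB (x, y) ((hG x y).2 (Or.inl hy))
    simp only at this
    omega
  have hhi : ∀ x : ℤ, (B : ℤ) - 2 ≤ x → G x = ∅ := by
    intro x hx
    rw [Finset.eq_empty_iff_forall_notMem]
    intro y hy
    have := hB (x + 2, y) ((hG (x + 2) y).2 (Or.inr (Or.inr (by simpa using hy))))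
    simp only at this
    omega
  obtain ⟨y0, l0, s0⟩ := parity_tour hP hG (-(B : ℤ)) B (fun x hx => hlo x (by omega))
    (fun c hc => by have := hB c hc; omega)
  obtain ⟨y1, l1, s1⟩ := parity_tour hP hG (-(B : ℤ) + 1) B (fun x hx => hlo x (by omega))
    (fun c hc => by have := hB c hc; omega)
  have tot := total h3 hp (-(B : ℤ)) (fun x hx => hlo x (by omega)) (2 * (B + 1))
  have hsum : ∑ k ∈ Finset.range (2 * (B + 1)), cost G (-(B : ℤ) + k) =
      (∑ k ∈ Finset.range B, cost G (-(B : ℤ) + 2 * k) + cost G (-(B : ℤ) + 2 * B)) +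
      (∑ k ∈ Finset.range B, cost G (-(B : ℤ) + 1 + 2 * k) + cost G (-(B : ℤ) + 1 + 2 * B)) := by
    rw [sum_parity (fun k => cost G (-(B : ℤ) + k)), ← Finset.sum_range_succ (fun k : ℕ =>
      cost G (-(B : ℤ) + 2 * k)), ← Finset.sum_range_succ (fun k : ℕ =>
      cost G (-(B : ℤ) + 1 + 2 * k))]
    congr 1
    · refine Finset.sum_congr rfl fun k _ => ?_
      congr 1 <;> (try push_cast) <;> (try ring)
  have hcol : ∑ k ∈ Finset.range (2 * (B + 1)), (COL G (-(B : ℤ) + k)).card ≤ P.card := by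
    rw [← Finset.card_sigma]
    refine Finset.card_le_card_of_injOn (fun s => ((-(B : ℤ) + (s.1 : ℤ), s.2) : Cell)) ?_ ?_
    · rintro ⟨k, y⟩ h
      have h' := (Finset.mem_sigma.1 h).2
      simp only [COL, Finset.mem_union] at h'
      exact (hG _ _).2 h'
    · rintro ⟨k, y⟩ _ ⟨k', y'⟩ _ h
      simp only [Prod.mk.injEq] at h
      obtain ⟨e1, rfl⟩ := h
      have : k = k' := by omega
      subst this
      rfl
  set n : ℤ := -(B : ℤ) + ((2 * (B + 1) : ℕ) : ℤ) with hn
  have hn' : n = B + 2 := by rw [hn]; push_cast; ring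
  have g0 : G n = ∅ := hhi _ (by omega)
  have g1 : G (n - 1) = ∅ := hhi _ (by omega)
  have g2 : G (n - 2) = ∅ := hhi _ (by omega)
  have g3 : G (n - 2 - 1) = ∅ := hhi _ (by omega)
  have g4 : G (n - 1 - 1) = ∅ := hhi _ (by omega)
  have d1 : (DD G (n - 1)).card = 0 := by simp [DD, g1, g4]
  have d2 : (DD G (n - 2)).card = 0 := by simp [DD, g2, g3]
  have p0 : Pot G n = 0 := by simp [Pot, g0, g1, g2, nr]
  rw [d1, d2, p0] at tot
  zify at hsum hcol
  have l0' := l0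
  have l1' := l1
  zify at l0' l1'
  by_cases hc : y0.2.length ≤ y1.2.length
  · exact ⟨y0, by omega, s0⟩
  · exact ⟨y1, by omega, s1⟩

/-- a simple grid polygon with `C` cells and no narrow-passage
cell admits, from some start cell, a closed covering walk of length at most
`(4/3)·C - 2`. -/
theorem no_narrow_passage_tour_bound (P : Finset Cell) (hP : SimplePolygon P)
    (hnp : ∀ c ∈ P, ¬ IsNarrowPassageCell P c) :
    ∃ s ∈ P, ∃ (w : ℕ → Cell) (n : ℕ),
      w 0 = s ∧ IsWalk P w n ∧ w n = s ∧ Covers P w n ∧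
      (n : ℝ) ≤ 4 / 3 * (P.card : ℝ) - 2 := by
  
  obtain ⟨y, hy, hs⟩ := short_tour P hP.1 hnp
  obtain ⟨s, hsP, w, n, h1, h2, h3, h4, h5⟩ := final_walk y hs
  refine ⟨s, hsP, w, n, h1, h2, h3, h4, ?_⟩
  have : (3 : ℝ) * ((n : ℝ) + 2) ≤ 4 * (P.card : ℝ) := by
    rw [h5]
    exact_mod_cast hy
  linarith
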